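/- For every integer t ≥ 3, there is an integer f(t) such that every simple 3-connected graph G with more than f(t) edges has, as a cc-minor, a fan-type graph F_{t_1, t_2, ..., t_n} with Σ_{i=1}^n t_i ≥ t. -/

import Mathlib

open scoped Classical

noncomputable section

/-- A finite multigraph with vertices and edge names drawn from `ℕ`.
Each edge name `e ∈ E` has a pair of (possibly equal) endpoints `ends e`. -/
structure MGraph where
  V : Finset ℕ
  E : Finset ℕ
  ends : ℕ → Sym2 ℕ
  ends_mem : ∀ e ∈ E, ∀ v ∈ ends e, v ∈ V

namespace MGraph

/-- Adjacency via some edge. -/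
def Adj (G : MGraph) (u v : ℕ) : Prop := ∃ e ∈ G.E, G.ends e = s(u, v)

/-- Reachability. -/
def Reach (G : MGraph) : ℕ → ℕ → Prop := Relation.ReflTransGen G.Adj

/-- A graph is connected if it has a vertex and all vertices are mutually reachable. -/
def Connected (G : MGraph) : Prop :=
  G.V.Nonempty ∧ ∀ u ∈ G.V, ∀ v ∈ G.V, G.Reach u v

/-- Delete a set of edges. -/
def deleteEdges (G : MGraph) (Z : Finset ℕ) : MGraph where
  V := G.V
  E := G.E \ Z
  ends := G.ends
  ends_mem := fun e he => G.ends_mem e (Finset.mem_sdiff.mp he).1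

/-- A graph with at least two vertices is `k`-edge-connected if deleting any
set of fewer than `k` edges leaves it connected. -/
def EdgeConnected (G : MGraph) (k : ℕ) : Prop :=
  2 ≤ G.V.card ∧ ∀ Z ⊆ G.E, Z.card < k → (G.deleteEdges Z).Connected

/-- A graph is loopless if no edge has equal endpoints. -/
def Loopless (G : MGraph) : Prop := ∀ e ∈ G.E, ¬ (G.ends e).IsDiag

/-- The set of vertices met by an edge set. -/
def vertsOf (G : MGraph) (C : Finset ℕ) : Finset ℕ :=
  G.V.filter (fun v => ∃ e ∈ C, v ∈ G.ends e)

/-- Degree of `v` in the edge set `C` (loops counted twice). -/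
def degIn (G : MGraph) (C : Finset ℕ) (v : ℕ) : ℕ :=
  ∑ e ∈ C, (if G.ends e = s(v, v) then 2 else if v ∈ G.ends e then 1 else 0)

/-- `C` is the edge set of a cycle of `G`: a nonempty connected edge set in which
every vertex met has degree exactly two (a loop and a pair of parallel edges are cycles). -/
def IsCycleSet (G : MGraph) (C : Finset ℕ) : Prop :=
  C.Nonempty ∧ C ⊆ G.E ∧
  (∀ v ∈ G.vertsOf C, G.degIn C v = 2) ∧
  ∀ u ∈ G.vertsOf C, ∀ v ∈ G.vertsOf C,
    Relation.ReflTransGen (fun a b => ∃ e ∈ C, G.ends e = s(a, b)) u v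

/-- The vertex map identifying all vertices of `U` (within `G.V`) to a single one. -/
def cmapOn (G : MGraph) (U : Finset ℕ) : ℕ → ℕ :=
  fun v => if v ∈ U ∩ G.V then sInf {w : ℕ | w ∈ U ∩ G.V} else v

/-- Contract the vertex set `U` to a single vertex, deleting the edges of `S` and all
newly created loops (edges with both ends in `U` that were not already loops), while
keeping pre-existing loops not in `S`. -/
def contractOn (G : MGraph) (U S : Finset ℕ) : MGraph where
  V := G.V.image (G.cmapOn U)
  E := G.E.filter (fun e => ¬ (∀ v ∈ G.ends e, v ∈ U) ∨ ((G.ends e).IsDiag ∧ e ∉ S))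
  ends := fun e => (G.ends e).map (G.cmapOn U)
  ends_mem := by
    intro e he v hv
    have he' : e ∈ G.E := (Finset.mem_filter.mp he).1
    rw [Sym2.mem_map] at hv
    obtain ⟨w, hw, rfl⟩ := hv
    have hwV : w ∈ G.V := G.ends_mem e he' w hw
    by_cases h : w ∈ U ∩ G.V
    · have hmem : sInf {x : ℕ | x ∈ U ∩ G.V} ∈ U ∩ G.V := Nat.sInf_mem ⟨w, h⟩
      refine Finset.mem_image.mpr ⟨sInf {x : ℕ | x ∈ U ∩ G.V},
        (Finset.mem_inter.mp hmem).2, ?_⟩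
      simp [cmapOn, h, hmem]
    · exact Finset.mem_image.mpr ⟨w, hwV, by simp [cmapOn, h]⟩

/-- Contract a cycle (given by its edge set), deleting all created loops. -/
def contractCycle (G : MGraph) (C : Finset ℕ) : MGraph :=
  G.contractOn (G.vertsOf C) C

/-- `H` is a cycle-contraction minor (cc-minor) of `G`: `H` is obtained from `G` by
a sequence of cycle contractions (each accompanied by contraction of created loops). -/
def CCMinor (G H : MGraph) : Prop :=
  Relation.ReflTransGen (fun A B => ∃ C, A.IsCycleSet C ∧ B = A.contractCycle C) G H

/-- Walks: a vertex list together with a matching edge list. -/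
inductive IsWalk (G : MGraph) : List ℕ → List ℕ → Prop
  | nil {v : ℕ} (hv : v ∈ G.V) : IsWalk G [v] []
  | cons {u v : ℕ} {e : ℕ} {vs es : List ℕ} (he : e ∈ G.E)
      (hends : G.ends e = s(u, v)) (hw : IsWalk G (v :: vs) es) :
      IsWalk G (u :: v :: vs) (e :: es)

/-- A path from `u` to `v`, given by its vertex list and edge list. -/
def IsPathBetween (G : MGraph) (u v : ℕ) (vs es : List ℕ) : Prop :=
  G.IsWalk vs es ∧ vs.Nodup ∧ vs.head? = some u ∧ vs.getLast? = some v

/-- `G` is `k`-connected: it has at least `k` vertices and any two distinct vertices are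
joined by at least `k` pairwise internally disjoint paths. -/
def KConnected (G : MGraph) (k : ℕ) : Prop :=
  k ≤ G.V.card ∧ ∀ u ∈ G.V, ∀ v ∈ G.V, u ≠ v →
    ∃ P : Fin k → List ℕ × List ℕ,
      (∀ i, G.IsPathBetween u v (P i).1 (P i).2) ∧
      ∀ i j, i ≠ j →
        (∀ x, x ∈ (P i).1 → x ∈ (P j).1 → x = u ∨ x = v) ∧
        (∀ e, e ∈ (P i).2 → e ∉ (P j).2)

/-- A simple graph: no loops and no parallel edges. -/
def Simple (G : MGraph) : Prop :=
  G.Loopless ∧ ∀ e ∈ G.E, ∀ f ∈ G.E, G.ends e = G.ends f → e = f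

/-- Graph isomorphism. -/
def Iso (G H : MGraph) : Prop :=
  ∃ φ ψ : ℕ → ℕ, Set.BijOn φ ↑G.V ↑H.V ∧ Set.BijOn ψ ↑G.E ↑H.E ∧
    ∀ e ∈ G.E, H.ends (ψ e) = (G.ends e).map φ

/-- The bond graph `B n`: two vertices joined by `n` parallel edges. -/
def IsBondGraph (H : MGraph) (n : ℕ) : Prop :=
  ∃ u v : ℕ, u ≠ v ∧ H.V = {u, v} ∧ H.E.card = n ∧ ∀ e ∈ H.E, H.ends e = s(u, v)

end MGraph

namespace MGraph

/-- `F` is a subgraph of `G`. -/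
def IsSubgraph (F G : MGraph) : Prop :=
  F.V ⊆ G.V ∧ F.E ⊆ G.E ∧ ∀ e ∈ F.E, F.ends e = G.ends e

end MGraph

/-- `H` is a fan-type graph with hub `u`, path `vs`, path edges `pE`, and, for each path
vertex `w`, a nonempty set `S w` of parallel spokes joining `u` to `w`. -/
def IsFanType (H : MGraph) (u : ℕ) (vs : List ℕ) (pE : List ℕ) (S : ℕ → Finset ℕ) : Prop :=
  vs ≠ [] ∧ vs.Nodup ∧ u ∉ vs ∧
  H.V = insert u vs.toFinset ∧
  pE.length + 1 = vs.length ∧ pE.Nodup ∧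
  (∀ i : ℕ, i + 1 < vs.length → pE[i]! ∈ H.E ∧ H.ends pE[i]! = s(vs[i]!, vs[i + 1]!)) ∧
  (∀ w ∈ vs, (S w).Nonempty ∧ ∀ g ∈ S w, g ∈ H.E ∧ H.ends g = s(u, w)) ∧
  H.E = pE.toFinset ∪ vs.toFinset.biUnion S

namespace MGraph

/-- The edges of `G` inside the vertex set `S` that leave `X`. -/
def cut (G : MGraph) (S : Finset ℕ) (X : Set ℕ) : Finset ℕ :=
  G.E.filter fun e => ∃ a b, G.ends e = s(a, b) ∧ a ∈ S ∧ b ∈ S ∧ a ∈ X ∧ b ∉ X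

/-- The subgraph induced on `S` is `k`-edge-connected, in terms of cuts. -/
def ECon (G : MGraph) (S : Finset ℕ) (k : ℕ) : Prop :=
  ∀ X : Set ℕ, ∀ a ∈ S, a ∈ X → ∀ b ∈ S, b ∉ X → k ≤ (G.cut S X).card

/-- The edges with both ends in `S`. -/
def inner (G : MGraph) (S : Finset ℕ) : Finset ℕ :=
  G.E.filter fun e => ∀ v ∈ G.ends e, v ∈ S

/-- The simple graph underlying an edge set. -/
def edgeGraph (G : MGraph) (F : Finset ℕ) : SimpleGraph ℕ where
  Adj a b := a ≠ b ∧ ∃ e ∈ F, G.ends e = s(a, b)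
  symm := ⟨by
    rintro a b ⟨h, e, he, h'⟩
    exact ⟨h.symm, e, he, h'.trans Sym2.eq_swap⟩⟩
  loopless := ⟨fun a h => h.1 rfl⟩

variable {G H : MGraph} {S T : Finset ℕ}

theorem mem_cut {X : Set ℕ} {e : ℕ} : e ∈ G.cut S X ↔
    e ∈ G.E ∧ ∃ a b, G.ends e = s(a, b) ∧ a ∈ S ∧ b ∈ S ∧ a ∈ X ∧ b ∉ X := by
  simp [cut]

theorem mem_inner {e a b : ℕ} (h : G.ends e = s(a, b)) :
    e ∈ G.inner S ↔ e ∈ G.E ∧ a ∈ S ∧ b ∈ S := by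
  simp [inner, h]

theorem inner_subset : G.inner S ⊆ G.E := Finset.filter_subset _ _

theorem inner_mono (h : S ⊆ T) : G.inner S ⊆ G.inner T := by
  intro e he
  simp only [inner, Finset.mem_filter] at he ⊢
  exact ⟨he.1, fun v hv => h (he.2 v hv)⟩

theorem exists_ends (G : MGraph) (e : ℕ) : ∃ a b, G.ends e = s(a, b) := by
  induction h : G.ends e with | _ a b => exact ⟨a, b, rfl⟩

theorem mem_V_of_ends {e a b : ℕ} (he : e ∈ G.E) (h : G.ends e = s(a, b)) :
    a ∈ G.V ∧ b ∈ G.V :=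
  ⟨G.ends_mem e he a (by simp [h]), G.ends_mem e he b (by simp [h])⟩

theorem Loopless.ne (hG : G.Loopless) {e a b : ℕ} (he : e ∈ G.E) (h : G.ends e = s(a, b)) :
    a ≠ b := by
  have := hG e he
  rw [h, Sym2.mk_isDiag_iff] at this
  exact this

theorem edgeGraph_mono {F F' : Finset ℕ} (h : F ⊆ F') : G.edgeGraph F ≤ G.edgeGraph F' := by
  rintro a b ⟨hab, e, he, h'⟩
  exact ⟨hab, e, h he, h'⟩

theorem reachable_of_edge {F : Finset ℕ} {e a b : ℕ} (he : e ∈ F) (h : G.ends e = s(a, b)) :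
    (G.edgeGraph F).Reachable a b := by
  by_cases hab : a = b
  · subst hab; exact SimpleGraph.Reachable.refl _
  · exact SimpleGraph.Adj.reachable ⟨hab, e, he, h⟩

theorem exists_crossing {F : Finset ℕ} {a b : ℕ} (h : (G.edgeGraph F).Reachable a b)
    (X : Set ℕ) (ha : a ∈ X) (hb : b ∉ X) :
    ∃ e ∈ F, ∃ c d, G.ends e = s(c, d) ∧ c ∈ X ∧ d ∉ X := by
  obtain ⟨p⟩ := h
  obtain ⟨d, -, h1, h2⟩ := p.exists_boundary_dart X ha hb
  obtain ⟨-, e, he, h'⟩ := d.adj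
  exact ⟨e, he, _, _, h', h1, h2⟩

theorem mem_of_reachable {a b : ℕ} (h : (G.edgeGraph (G.inner S)).Reachable a b) (ha : a ∈ S) :
    b ∈ S := by
  by_contra hb
  obtain ⟨e, he, c, d, h', -, hd⟩ := exists_crossing h (↑S) ha hb
  exact hd ((mem_inner h').1 he).2.2

theorem ECon.reachable (h : G.ECon S 1) {a b : ℕ} (ha : a ∈ S) (hb : b ∈ S) :
    (G.edgeGraph (G.inner S)).Reachable a b := by
  by_contra hab
  have := h {v | (G.edgeGraph (G.inner S)).Reachable a v} a ha (SimpleGraph.Reachable.refl _) b hb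
    hab
  obtain ⟨e, he⟩ := Finset.card_pos.1 this
  obtain ⟨heE, c, d, he', hc, hd, hcX, hdX⟩ := mem_cut.1 he
  exact hdX (hcX.trans (reachable_of_edge ((mem_inner he').2 ⟨heE, hc, hd⟩) he'))

theorem ECon_one_of_reachable
    (h : ∀ a ∈ S, ∀ b ∈ S, (G.edgeGraph (G.inner S)).Reachable a b) : G.ECon S 1 := by
  intro X a ha haX b hb hbX
  obtain ⟨e, he, c, d, h', hc, hd⟩ := exists_crossing (h a ha b hb) X haX hbX
  obtain ⟨h1, h2, h3⟩ := (mem_inner h').1 he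
  exact Finset.card_pos.2 ⟨e, mem_cut.2 ⟨h1, c, d, h', h2, h3, hc, hd⟩⟩

theorem ECon_one_of_reachable_from {r : ℕ}
    (h : ∀ a ∈ S, (G.edgeGraph (G.inner S)).Reachable r a) : G.ECon S 1 :=
  ECon_one_of_reachable fun a ha b hb => (h a ha).symm.trans (h b hb)

/-- Adding a neighbour keeps a vertex set connected. -/
theorem ECon.insert (h : G.ECon S 1) {a v : ℕ} (ha : a ∈ S) (hav : G.Adj a v) :
    G.ECon (insert v S) 1 := by
  have h1 := edgeGraph_mono (G := G) (inner_mono (G := G) (Finset.subset_insert v S))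
  apply ECon_one_of_reachable_from (r := a)
  intro b hb
  rcases Finset.mem_insert.1 hb with rfl | hb
  · obtain ⟨e, he, h'⟩ := hav
    exact reachable_of_edge ((mem_inner h').2 ⟨he, by simp [ha], by simp⟩) h'
  · exact (h.reachable ha hb).mono h1

/-- The component of `a` in the subgraph induced on `S`. -/
def comp (G : MGraph) (S : Finset ℕ) (a : ℕ) : Finset ℕ :=
  S.filter fun v => (G.edgeGraph (G.inner S)).Reachable a v

theorem comp_subset {a : ℕ} : G.comp S a ⊆ S := Finset.filter_subset _ _

theorem self_mem_comp {a : ℕ} (ha : a ∈ S) : a ∈ G.comp S a := by simp [comp, ha]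

theorem comp_closed {a e c d : ℕ} (he : e ∈ G.E) (h : G.ends e = s(c, d)) (hc : c ∈ G.comp S a)
    (hd : d ∈ S) : d ∈ G.comp S a := by
  simp only [comp, Finset.mem_filter] at hc ⊢
  exact ⟨hd, hc.2.trans (reachable_of_edge ((mem_inner h).2 ⟨he, hc.1, hd⟩) h)⟩

theorem ECon_comp {a : ℕ} (ha : a ∈ S) : G.ECon (G.comp S a) 1 := by
  apply ECon_one_of_reachable_from (r := a)
  intro b hb
  by_contra hab
  obtain ⟨e, he, c, d, h', hc, hd⟩ := exists_crossing (Finset.mem_filter.1 hb).2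
    {v | v ∈ G.comp S a ∧ (G.edgeGraph (G.inner (G.comp S a))).Reachable a v}
    ⟨self_mem_comp ha, SimpleGraph.Reachable.refl _⟩ (fun h => hab h.2)
  obtain ⟨h1, h2, h3⟩ := (mem_inner h').1 he
  have := comp_closed h1 h' hc.1 h3
  exact hd ⟨this, hc.2.trans (reachable_of_edge ((mem_inner h').2 ⟨h1, hc.1, this⟩) h')⟩

theorem subset_comp {a : ℕ} (hT : G.ECon T 1) (hTS : T ⊆ S) (ha : a ∈ T) : T ⊆ G.comp S a :=
  fun _ hb => Finset.mem_filter.2 ⟨hTS hb,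
    (hT.reachable ha hb).mono (edgeGraph_mono (inner_mono hTS))⟩

/-- An injective enumeration of a path joining two reachable vertices. -/
theorem exists_path {F : Finset ℕ} {a b : ℕ} (h : (G.edgeGraph F).Reachable a b) :
    ∃ (n : ℕ) (f : ℕ → ℕ) (g : ℕ → ℕ), f 0 = a ∧ f n = b ∧
      (∀ i ≤ n, ∀ j ≤ n, f i = f j → i = j) ∧
      (∀ i < n, g i ∈ F ∧ G.ends (g i) = s(f i, f (i + 1))) ∧
      ∃ p : (G.edgeGraph F).Walk a b, p.length = n := by
  obtain ⟨q⟩ := h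
  let p := q.toPath
  have hadj : ∀ i, ∃ e, i < p.1.length →
      e ∈ F ∧ G.ends e = s(p.1.getVert i, p.1.getVert (i + 1)) := by
    intro i
    by_cases hi : i < p.1.length
    · obtain ⟨-, e, he⟩ := p.1.adj_getVert_succ hi
      exact ⟨e, fun _ => he⟩
    · exact ⟨0, fun h => absurd h hi⟩
  choose g hg using hadj
  refine ⟨p.1.length, p.1.getVert, g, by simp, by simp, ?_, fun i hi => hg i hi, p.1, rfl⟩
  intro i hi j hj hij
  exact p.2.getVert_injOn hi hj hij

theorem edge_injective {n : ℕ} {f g : ℕ → ℕ} (hf : ∀ i ≤ n, ∀ j ≤ n, f i = f j → i = j)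
    (hg : ∀ i < n, G.ends (g i) = s(f i, f (i + 1))) :
    ∀ i < n, ∀ j < n, g i = g j → i = j := by
  intro i hi j hj hij
  have h := hg i hi
  rw [hij, hg j hj, Sym2.eq_iff] at h
  rcases h with ⟨h, -⟩ | ⟨h1, h2⟩
  · exact (hf _ hj.le _ hi.le h).symm
  · have := hf _ hj.le _ hi h1
    have := hf _ hj _ hi.le h2
    omega

theorem reachable_of_seq {F : Finset ℕ} {f g : ℕ → ℕ} {i j : ℕ} (hij : i ≤ j)
    (hg : ∀ k, i ≤ k → k < j → g k ∈ F ∧ G.ends (g k) = s(f k, f (k + 1))) :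
    (G.edgeGraph F).Reachable (f i) (f j) := by
  induction j, hij using Nat.le_induction with
  | base => exact SimpleGraph.Reachable.refl _
  | succ j hij ih =>
    have := hg j hij (by omega)
    exact (ih fun k h1 h2 => hg k h1 (by omega)).trans (reachable_of_edge this.1 this.2)

/-- An edge whose ends are joined by other edges of `F` lies on a cycle in `F`. -/
theorem exists_cycle (hG : G.Loopless) {F : Finset ℕ} (hF : F ⊆ G.E) {e a b : ℕ} (he : e ∈ F)
    (hab : G.ends e = s(a, b)) (h : (G.edgeGraph (F.erase e)).Reachable a b) :
    ∃ C ⊆ F, G.IsCycleSet C := by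
  obtain ⟨n, f, g, rfl, rfl, hf, hg, -⟩ := exists_path h
  have hgi := edge_injective hf (fun i hi => (hg i hi).2)
  have hgE : ∀ i < n, g i ∈ G.E := fun i hi => hF (Finset.mem_of_mem_erase (hg i hi).1)
  set C : Finset ℕ := insert e ((Finset.range n).image g) with hC
  have hCF : C ⊆ F := by
    intro x hx
    rcases Finset.mem_insert.1 hx with rfl | hx
    · exact he
    · obtain ⟨i, hi, rfl⟩ := Finset.mem_image.1 hx
      exact Finset.mem_of_mem_erase (hg i (Finset.mem_range.1 hi)).1
  have hverts : ∀ v ∈ G.vertsOf C, ∃ i ≤ n, f i = v := by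
    intro v hv
    obtain ⟨-, x, hx, hvx⟩ := Finset.mem_filter.1 hv
    rcases Finset.mem_insert.1 hx with rfl | hx
    · rw [hab, Sym2.mem_iff] at hvx
      rcases hvx with rfl | rfl
      · exact ⟨0, by omega, rfl⟩
      · exact ⟨n, le_rfl, rfl⟩
    · obtain ⟨i, hi, rfl⟩ := Finset.mem_image.1 hx
      rw [Finset.mem_range] at hi
      rw [(hg i hi).2, Sym2.mem_iff] at hvx
      rcases hvx with rfl | rfl
      · exact ⟨i, hi.le, rfl⟩
      · exact ⟨i + 1, hi, rfl⟩
  have hterm : ∀ {x c d : ℕ} (v : ℕ), x ∈ G.E → G.ends x = s(c, d) →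
      (if G.ends x = s(v, v) then 2 else if v ∈ G.ends x then 1 else 0)
        = (if c = v then 1 else 0) + (if d = v then 1 else 0) := by
    intro x c d v hx hcd
    have hne := hG.ne hx hcd
    rw [hcd]
    have h1 : s(c, d) ≠ s(v, v) := by
      intro h
      rw [Sym2.eq_iff] at h
      rcases h with ⟨rfl, rfl⟩ | ⟨rfl, rfl⟩ <;> exact hne rfl
    rw [if_neg h1]
    simp only [Sym2.mem_iff]
    by_cases h2 : c = v
    · have : d ≠ v := fun h => hne (h2.trans h.symm)
      simp [h2, this]
    · by_cases h3 : d = v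
      · simp [h2, h3]
      · simp [h2, h3, Ne.symm h2, Ne.symm h3]
  refine ⟨C, hCF, ⟨e, by simp [hC]⟩, hCF.trans hF, ?_, ?_⟩
  · intro v hv
    obtain ⟨j, hj, rfl⟩ := hverts v hv
    have hnot : e ∉ (Finset.range n).image g := by
      intro h
      obtain ⟨i, hi, h⟩ := Finset.mem_image.1 h
      exact Finset.ne_of_mem_erase (hg i (Finset.mem_range.1 hi)).1 h
    have hone : ∑ i ∈ Finset.range (n + 1), (if f i = f j then 1 else 0) = 1 := by
      rw [Finset.sum_eq_single j]
      · simp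
      · intro i hi hij
        rw [Finset.mem_range] at hi
        rw [if_neg fun h => hij (hf _ (by omega) _ hj h)]
      · intro h
        simp at h; omega
    rw [degIn, hC, Finset.sum_insert hnot, hterm _ (hF he) hab, Finset.sum_image]
    · rw [Finset.sum_congr rfl fun i hi => hterm (f j) (hgE i (Finset.mem_range.1 hi))
        (hg i (Finset.mem_range.1 hi)).2, Finset.sum_add_distrib]
      have h1 := hone
      rw [Finset.sum_range_succ] at h1
      have h2 := hone
      rw [Finset.sum_range_succ'] at h2
      omega
    · intro i hi k hk h
      simp only [Finset.coe_range, Set.mem_Iio] at hi hk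
      exact hgi i hi k hk h
  · have hsymm : Std.Symm (fun a b => ∃ e ∈ C, G.ends e = s(a, b)) := ⟨by
      rintro a b ⟨e, he, h⟩
      exact ⟨e, he, h.trans Sym2.eq_swap⟩⟩
    have hfrom : ∀ i ≤ n, Relation.ReflTransGen (fun a b => ∃ e ∈ C, G.ends e = s(a, b))
        (f 0) (f i) := by
      intro i
      induction i with
      | zero => intro _; exact Relation.ReflTransGen.refl
      | succ i ih =>
        intro hi
        refine (ih (by omega)).tail ⟨g i, ?_, (hg i hi).2⟩
        exact Finset.mem_insert_of_mem (Finset.mem_image_of_mem _ (Finset.mem_range.2 hi))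
    intro u hu v hv
    obtain ⟨i, hi, rfl⟩ := hverts u hu
    obtain ⟨j, hj, rfl⟩ := hverts v hv
    exact (symm (hfrom i hi)).trans (hfrom j hj)

end MGraph

namespace MGraph

variable {G H : MGraph} {S T U : Finset ℕ}

/-- The vertex that represents `U` after contraction. -/
def hub (G : MGraph) (U : Finset ℕ) : ℕ := sInf {w : ℕ | w ∈ U ∩ G.V}

theorem hub_mem (hU : U ⊆ G.V) (hne : U.Nonempty) : G.hub U ∈ U := by
  have : ({w : ℕ | w ∈ U ∩ G.V} : Set ℕ).Nonempty := by
    obtain ⟨a, ha⟩ := hne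
    exact ⟨a, Finset.mem_inter.2 ⟨ha, hU ha⟩⟩
  exact (Finset.mem_inter.1 (Nat.sInf_mem this)).1

theorem cmapOn_of_mem (hU : U ⊆ G.V) {v : ℕ} (hv : v ∈ U) : G.cmapOn U v = G.hub U := by
  rw [cmapOn, if_pos (Finset.mem_inter.2 ⟨hv, hU hv⟩), hub]

theorem cmapOn_of_notMem {v : ℕ} (hv : v ∉ U) : G.cmapOn U v = v := by
  rw [cmapOn, if_neg fun h => hv (Finset.mem_inter.1 h).1]

theorem cmapOn_eq_iff (hU : U ⊆ G.V) {a b : ℕ} :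
    G.cmapOn U a = G.cmapOn U b ↔ a = b ∨ (a ∈ U ∧ b ∈ U) := by
  by_cases ha : a ∈ U <;> by_cases hb : b ∈ U
  · simp [cmapOn_of_mem hU, ha, hb]
  · have := hub_mem hU ⟨a, ha⟩
    rw [cmapOn_of_mem hU ha, cmapOn_of_notMem hb]
    exact ⟨fun h => absurd (h ▸ this) hb, by rintro (rfl | h) <;> simp_all⟩
  · have := hub_mem hU ⟨b, hb⟩
    rw [cmapOn_of_mem hU hb, cmapOn_of_notMem ha]
    exact ⟨fun h => absurd (h ▸ this) ha, by rintro (rfl | h) <;> simp_all⟩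
  · simp [cmapOn_of_notMem, ha, hb]

theorem cmapOn_eq_hub_iff (hU : U ⊆ G.V) (hne : U.Nonempty) {a : ℕ} :
    G.cmapOn U a = G.hub U ↔ a ∈ U := by
  have h := hub_mem hU hne
  rw [← cmapOn_of_mem hU h, cmapOn_eq_iff hU]
  constructor
  · rintro (rfl | h')
    · exact h
    · exact h'.1
  · exact fun h' => Or.inr ⟨h', h⟩

theorem contractOn_ends {e a b : ℕ} (h : G.ends e = s(a, b)) :
    (G.contractOn U S).ends e = s(G.cmapOn U a, G.cmapOn U b) := by
  simp [contractOn, h]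

theorem mem_contractOn_E (hG : G.Loopless) {e a b : ℕ} (h : G.ends e = s(a, b)) :
    e ∈ (G.contractOn U S).E ↔ e ∈ G.E ∧ ¬ (a ∈ U ∧ b ∈ U) := by
  simp only [contractOn, Finset.mem_filter, h, Sym2.mem_iff, forall_eq_or_imp, forall_eq]
  constructor
  · rintro ⟨h1, h2 | ⟨h2, -⟩⟩
    · exact ⟨h1, h2⟩
    · exact absurd (Sym2.mk_isDiag_iff.1 h2) (hG.ne h1 h)
  · exact fun h' => ⟨h'.1, Or.inl h'.2⟩

theorem Loopless.contractOn (hG : G.Loopless) (hU : U ⊆ G.V) : (G.contractOn U S).Loopless := by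
  intro e he
  obtain ⟨a, b, hab⟩ := G.exists_ends e
  have := (mem_contractOn_E hG hab).1 he
  rw [contractOn_ends hab, Sym2.mk_isDiag_iff, cmapOn_eq_iff hU]
  rintro (h | h)
  · exact hG.ne this.1 hab h
  · exact this.2 h

theorem cut_subset_contractOn (hG : G.Loopless) (hU : U ⊆ G.V) (X : Set ℕ) :
    G.cut T (G.cmapOn U ⁻¹' X) ⊆ (G.contractOn U S).cut (T.image (G.cmapOn U)) X := by
  intro e he
  obtain ⟨heE, a, b, hab, ha, hb, haX, hbX⟩ := mem_cut.1 he
  refine mem_cut.2 ⟨(mem_contractOn_E hG hab).2 ⟨heE, fun h => ?_⟩, _, _, contractOn_ends hab,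
    Finset.mem_image_of_mem _ ha, Finset.mem_image_of_mem _ hb, haX, hbX⟩
  have := (cmapOn_eq_iff hU).2 (Or.inr h)
  exact hbX (by simpa only [Set.mem_preimage, ← this] using haX)

theorem ECon.contractOn (hG : G.Loopless) (hU : U ⊆ G.V) {k : ℕ} (h : G.ECon T k) :
    (G.contractOn U S).ECon (T.image (G.cmapOn U)) k := by
  intro X a ha haX b hb hbX
  obtain ⟨a', ha', rfl⟩ := Finset.mem_image.1 ha
  obtain ⟨b', hb', rfl⟩ := Finset.mem_image.1 hb
  exact (h (G.cmapOn U ⁻¹' X) a' ha' haX b' hb' hbX).trans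
    (Finset.card_le_card (cut_subset_contractOn hG hU X))

theorem ext_of {G H : MGraph} (hV : G.V = H.V) (hE : G.E = H.E) (h : G.ends = H.ends) : G = H := by
  cases G; cases H; simp_all

theorem contractOn_singleton (hG : G.Loopless) {a : ℕ} (ha : a ∈ G.V) :
    G.contractOn {a} S = G := by
  have hU : ({a} : Finset ℕ) ⊆ G.V := by simpa
  have hc : G.cmapOn {a} = id := by
    funext v
    by_cases hv : v ∈ ({a} : Finset ℕ)
    · have := hub_mem hU ⟨a, by simp⟩
      rw [cmapOn_of_mem hU hv, Finset.mem_singleton.1 this, Finset.mem_singleton.1 hv, id]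
    · exact cmapOn_of_notMem hv
  apply ext_of
  · simp [contractOn, hc]
  · ext e
    obtain ⟨c, d, hcd⟩ := G.exists_ends e
    rw [mem_contractOn_E hG hcd]
    constructor
    · exact fun h => h.1
    · refine fun h => ⟨h, fun h' => hG.ne h hcd ?_⟩
      rw [Finset.mem_singleton.1 h'.1, Finset.mem_singleton.1 h'.2]
  · funext e
    simp [contractOn, hc]

/-- Contracting a part of `U` first does not change the result of contracting `U`. -/
theorem contractOn_contractOn (hG : G.Loopless) (hU : U ⊆ G.V) {W R R' : Finset ℕ} (hW : W ⊆ U) :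
    (G.contractOn W R).contractOn (U.image (G.cmapOn W)) R' = G.contractOn U S := by
  have hWV := hW.trans hU
  have hU1 : U.image (G.cmapOn W) ⊆ (G.contractOn W R).V := Finset.image_subset_image hU
  have hG1 : (G.contractOn W R).Loopless := hG.contractOn hWV
  have hsub : U.image (G.cmapOn W) ⊆ U := by
    intro x hx
    obtain ⟨v, hv, rfl⟩ := Finset.mem_image.1 hx
    by_cases h : v ∈ W
    · rw [cmapOn_of_mem hWV h]; exact hW (hub_mem hWV ⟨v, h⟩)
    · rwa [cmapOn_of_notMem h]
  have hmem : ∀ v, G.cmapOn W v ∈ U.image (G.cmapOn W) ↔ v ∈ U := by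
    intro v
    constructor
    · intro h
      by_cases hv : v ∈ W
      · exact hW hv
      · rw [cmapOn_of_notMem hv] at h; exact hsub h
    · exact fun h => Finset.mem_image_of_mem _ h
  have hhub : U.Nonempty → (G.contractOn W R).hub (U.image (G.cmapOn W)) = G.hub U := by
    intro hne
    have h1 := hub_mem hU1 (hne.image _)
    have h2 := hub_mem hU hne
    apply le_antisymm
    · have h3 : G.cmapOn W (G.hub U) ≤ G.hub U := by
        by_cases h : G.hub U ∈ W
        · rw [cmapOn_of_mem hWV h]
          exact Nat.sInf_le (Finset.mem_inter.2 ⟨h, hWV h⟩)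
        · rw [cmapOn_of_notMem h]
      refine le_trans (Nat.sInf_le ?_) h3
      have := Finset.mem_image_of_mem (G.cmapOn W) h2
      exact Finset.mem_inter.2 ⟨this, hU1 this⟩
    · exact Nat.sInf_le (Finset.mem_inter.2 ⟨hsub h1, hU (hsub h1)⟩)
  have hc : ∀ v, (G.contractOn W R).cmapOn (U.image (G.cmapOn W)) (G.cmapOn W v)
      = G.cmapOn U v := by
    intro v
    by_cases hv : v ∈ U
    · rw [cmapOn_of_mem hU1 ((hmem v).2 hv), cmapOn_of_mem hU hv, hhub ⟨v, hv⟩]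
    · rw [cmapOn_of_notMem (fun h => hv ((hmem v).1 h)), cmapOn_of_notMem hv,
        cmapOn_of_notMem (fun h => hv (hW h))]
  apply ext_of
  · exact Finset.image_image.trans (congrArg (fun k => G.V.image k) (funext hc))
  · ext e
    obtain ⟨a, b, hab⟩ := G.exists_ends e
    rw [mem_contractOn_E hG1 (contractOn_ends hab), mem_contractOn_E hG hab,
      mem_contractOn_E hG hab, hmem, hmem]
    constructor
    · exact fun h => ⟨h.1.1, h.2⟩
    · exact fun h => ⟨⟨h.1, fun h' => h.2 ⟨hW h'.1, hW h'.2⟩⟩, h.2⟩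
  · funext e
    obtain ⟨a, b, hab⟩ := G.exists_ends e
    rw [contractOn_ends (contractOn_ends hab), contractOn_ends hab, hc, hc]

theorem vertsOf_subset {C : Finset ℕ} : G.vertsOf C ⊆ G.V := Finset.filter_subset _ _

theorem vertsOf_subset_of_inner {C : Finset ℕ} (hC : C ⊆ G.inner S) : G.vertsOf C ⊆ S := by
  intro v hv
  obtain ⟨-, e, he, hv⟩ := Finset.mem_filter.1 hv
  exact (Finset.mem_filter.1 (hC he)).2 v hv

theorem exists_two_vertsOf (hG : G.Loopless) {C : Finset ℕ} (hC : G.IsCycleSet C) :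
    ∃ a ∈ G.vertsOf C, ∃ b ∈ G.vertsOf C, a ≠ b := by
  obtain ⟨⟨e, he⟩, hCE, -, -⟩ := hC
  obtain ⟨a, b, hab⟩ := G.exists_ends e
  have ha : a ∈ G.ends e := by simp [hab]
  have hb : b ∈ G.ends e := by simp [hab]
  exact ⟨a, Finset.mem_filter.2 ⟨G.ends_mem e (hCE he) a ha, e, he, ha⟩,
    b, Finset.mem_filter.2 ⟨G.ends_mem e (hCE he) b hb, e, he, hb⟩, hG.ne (hCE he) hab⟩

theorem card_image_cmapOn_lt (hU : U ⊆ G.V) (hUT : U ⊆ T) {a b : ℕ} (ha : a ∈ U) (hb : b ∈ U)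
    (hab : a ≠ b) : (T.image (G.cmapOn U)).card < T.card := by
  refine lt_of_le_of_ne Finset.card_image_le fun h => hab ?_
  exact Finset.card_image_iff.1 h (hUT ha) (hUT hb) ((cmapOn_eq_iff hU).2 (Or.inr ⟨ha, hb⟩))

/-- A bridgeless connected induced subgraph can be contracted by cycle contractions. -/
theorem ccMinor_contractOn (n : ℕ) : ∀ {G : MGraph} {U S : Finset ℕ}, U.card ≤ n → G.Loopless →
    U ⊆ G.V → U.Nonempty → G.ECon U 2 → G.CCMinor (G.contractOn U S) := by
  induction n with
  | zero =>
    intro G U S hn _ _ hne _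
    exact absurd (Finset.card_pos.2 hne) (by omega)
  | succ n ih =>
    intro G U S hn hG hU hne hcon
    obtain ⟨a, ha⟩ := hne
    by_cases hsing : U = {a}
    · subst hsing
      rw [contractOn_singleton hG (hU ha)]
      exact Relation.ReflTransGen.refl
    obtain ⟨b, hb, hba⟩ : ∃ b ∈ U, b ≠ a := by
      by_contra! h
      exact hsing (Finset.eq_singleton_iff_unique_mem.2 ⟨ha, h⟩)
    have h2 := hcon {a} a ha rfl b hb hba
    obtain ⟨e, he⟩ := Finset.card_pos.1 (by omega : 0 < (G.cut U {a}).card)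
    obtain ⟨heE, c, d, hcd, hc, hd, -, -⟩ := mem_cut.1 he
    have hein : e ∈ G.inner U := (mem_inner hcd).2 ⟨heE, hc, hd⟩
    have hreach : (G.edgeGraph ((G.inner U).erase e)).Reachable c d := by
      by_contra hnr
      have h3 := hcon {v | (G.edgeGraph ((G.inner U).erase e)).Reachable c v} c hc
        (SimpleGraph.Reachable.refl _) d hd hnr
      obtain ⟨e', he', hne⟩ := Finset.exists_mem_ne h3 e
      obtain ⟨heE', c', d', hcd', hc', hd', hcX, hdX⟩ := mem_cut.1 he'
      exact hdX (hcX.trans (reachable_of_edge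
        (Finset.mem_erase.2 ⟨hne, (mem_inner hcd').2 ⟨heE', hc', hd'⟩⟩) hcd'))
    obtain ⟨C, hCU, hC⟩ := exists_cycle hG inner_subset hein hcd hreach
    have hCU' := vertsOf_subset_of_inner hCU
    obtain ⟨x, hx, y, hy, hxy⟩ := exists_two_vertsOf hG hC
    have hlt := card_image_cmapOn_lt vertsOf_subset hCU' hx hy hxy
    have := ih (G := G.contractCycle C) (U := U.image (G.cmapOn (G.vertsOf C))) (S := S)
      (by omega) (hG.contractOn vertsOf_subset) (Finset.image_subset_image hU)
      ⟨_, Finset.mem_image_of_mem _ ha⟩ (hcon.contractOn hG vertsOf_subset)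
    rw [contractCycle, contractOn_contractOn (S := S) hG hU hCU'] at this
    exact Relation.ReflTransGen.head ⟨C, hC, rfl⟩ this

end MGraph

namespace MGraph

variable {G H : MGraph} {S T U : Finset ℕ}

theorem cut_compl (X : Set ℕ) : G.cut S Xᶜ = G.cut S X := by
  ext e
  simp only [mem_cut, Set.mem_compl_iff, not_not]
  constructor <;>
  · rintro ⟨he, a, b, h, ha, hb, haX, hbX⟩
    exact ⟨he, b, a, h.trans Sym2.eq_swap, hb, ha, hbX, haX⟩

theorem cut_subset_cut (h : S ⊆ T) (X : Set ℕ) : G.cut S X ⊆ G.cut T X := by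
  intro e he
  obtain ⟨he, a, b, h', ha, hb, haX, hbX⟩ := mem_cut.1 he
  exact mem_cut.2 ⟨he, a, b, h', h ha, h hb, haX, hbX⟩

/-- Vertices outside `K` with a neighbour in `K` are at most as many as the edges leaving `K`. -/
theorem card_le_of_edges {N F K : Finset ℕ}
    (h : ∀ w ∈ N, w ∉ K ∧ ∃ e ∈ F, ∃ z ∈ K, G.ends e = s(w, z)) : N.card ≤ F.card := by
  have h' : ∀ w, ∃ e, w ∈ N → e ∈ F ∧ ∃ z ∈ K, G.ends e = s(w, z) := by
    intro w
    by_cases hw : w ∈ N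
    · obtain ⟨-, e, he⟩ := h w hw
      exact ⟨e, fun _ => he⟩
    · exact ⟨0, fun h => absurd h hw⟩
  choose g hg using h'
  refine Finset.card_le_card_of_injOn g (fun w hw => (hg w hw).1) ?_
  intro w hw w' hw' hww
  obtain ⟨-, z, hz, h1⟩ := hg w hw
  obtain ⟨-, z', hz', h2⟩ := hg w' hw'
  rw [hww, h2, Sym2.eq_iff] at h1
  rcases h1 with ⟨h1, -⟩ | ⟨h1, -⟩
  · exact h1.symm
  · exact ((h w' hw').1 (h1 ▸ hz)).elim

/-- In a large connected graph of bounded degree some vertex is far from a given one. -/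
theorem exists_far {Δ D a : ℕ} (hΔ : ∀ v ∈ S, (G.cut S {v}).card ≤ Δ)
    (hS : (Δ + 1) ^ D < S.card) :
    ∃ y ∈ S, ∀ p : (G.edgeGraph (G.inner S)).Walk a y, D < p.length := by
  have key : ∀ D, ∃ B : Finset ℕ, B.card ≤ (Δ + 1) ^ D ∧
      ∀ y ∈ S, ∀ p : (G.edgeGraph (G.inner S)).Walk y a, p.length ≤ D → y ∈ B := by
    intro D
    induction D with
    | zero =>
      refine ⟨{a}, by simp, fun y _ p hp => ?_⟩
      cases p with
      | nil => simp
      | cons _ _ => simp at hp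
    | succ D ih =>
      obtain ⟨B, hB, hmem⟩ := ih
      let N : ℕ → Finset ℕ := fun v => S.filter (fun w => (G.edgeGraph (G.inner S)).Adj v w)
      refine ⟨(B ∩ S).biUnion fun v => insert v (N v), ?_, fun y hy p hp => ?_⟩
      · have hN : ∀ v ∈ B ∩ S, (insert v (N v)).card ≤ Δ + 1 := by
          intro v hv
          refine (Finset.card_insert_le _ _).trans (Nat.add_le_add_right (le_trans ?_
            (hΔ v (Finset.mem_inter.1 hv).2)) 1)
          refine card_le_of_edges (G := G) (K := {v}) fun w hw => ?_
          obtain ⟨hwS, hne, e, he, h'⟩ := Finset.mem_filter.1 hw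
          refine ⟨by simpa using hne.symm, e, ?_, v, by simp, h'.trans Sym2.eq_swap⟩
          exact mem_cut.2 ⟨inner_subset he, v, w, h', (Finset.mem_inter.1 hv).2, hwS, rfl,
            by simpa using hne.symm⟩
        calc _ ≤ (B ∩ S).card * (Δ + 1) := Finset.card_biUnion_le_card_mul _ _ _ hN
          _ ≤ (Δ + 1) ^ D * (Δ + 1) := Nat.mul_le_mul_right _
            ((Finset.card_le_card Finset.inter_subset_left).trans hB)
          _ = _ := (pow_succ _ _).symm
      · by_cases hyB : y ∈ B
        · exact Finset.mem_biUnion.2 ⟨y, Finset.mem_inter.2 ⟨hyB, hy⟩, by simp⟩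
        cases p with
        | nil => exact absurd (hmem a hy .nil (by simp)) hyB
        | @cons _ z _ h q =>
          obtain ⟨-, e, he, h'⟩ := id h
          have hz : z ∈ S := ((mem_inner h').1 he).2.2
          have hzB := hmem z hz q (by simpa using hp)
          refine Finset.mem_biUnion.2 ⟨z, Finset.mem_inter.2 ⟨hzB, hz⟩, ?_⟩
          exact Finset.mem_insert_of_mem (Finset.mem_filter.2 ⟨hy, h.symm⟩)
  obtain ⟨B, hB, hmem⟩ := key D
  obtain ⟨y, hy, hyB⟩ := Finset.exists_mem_notMem_of_card_lt_card (hB.trans_lt hS)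
  refine ⟨y, hy, fun p => ?_⟩
  by_contra hp
  exact hyB (hmem y hy p.reverse (by simpa using hp))

/-- A 3-edge-connected graph with a vertex `u` of degree at least `d` that is not a cut vertex. -/
structure IsHubbed (G : MGraph) (u d : ℕ) : Prop where
  loopless : G.Loopless
  econ : G.ECon G.V 3
  mem : u ∈ G.V
  nonempty : (G.V.erase u).Nonempty
  rest : G.ECon (G.V.erase u) 1
  deg : d ≤ (G.cut G.V {u}).card

theorem isHubbed_contractOn (hG : G.Loopless) (h3 : G.ECon G.V 3) (hU : U ⊆ G.V)
    (hne : U.Nonempty) (hne' : (G.V \ U).Nonempty) (hK : G.ECon (G.V \ U) 1) :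
    (G.contractOn U S).IsHubbed (G.hub U) (G.cut G.V U).card := by
  have hh : ∀ {a}, G.cmapOn U a = G.hub U ↔ a ∈ U := cmapOn_eq_hub_iff hU hne
  have hV : (G.contractOn U S).V.erase (G.hub U) = (G.V \ U).image (G.cmapOn U) := by
    ext x
    simp only [contractOn, Finset.mem_erase, Finset.mem_image, Finset.mem_sdiff]
    constructor
    · rintro ⟨h, a, ha, rfl⟩
      exact ⟨a, ⟨ha, fun h' => h (hh.2 h')⟩, rfl⟩
    · rintro ⟨a, ⟨ha, h⟩, rfl⟩
      exact ⟨fun h' => h (hh.1 h'), a, ha, rfl⟩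
  refine ⟨hG.contractOn hU, h3.contractOn hG hU, ?_, ?_, ?_, ?_⟩
  · have := hub_mem hU hne
    rw [← hh.2 this]
    exact Finset.mem_image_of_mem _ (hU this)
  · rw [hV]; exact hne'.image _
  · rw [hV]; exact hK.contractOn hG hU
  · have hX : G.cmapOn U ⁻¹' {G.hub U} = (U : Set ℕ) := by
      ext a; simp [hh]
    rw [← hX]
    exact Finset.card_le_card (cut_subset_contractOn hG hU _)

theorem IsHubbed.contractOn {u d : ℕ} (h : G.IsHubbed u d) (hU : U ⊆ G.V.erase u) :
    (G.contractOn U S).IsHubbed u d := by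
  have hUV : U ⊆ G.V := hU.trans (Finset.erase_subset _ _)
  have hu : u ∉ U := fun h' => by simpa using hU h'
  have hcu : G.cmapOn U u = u := cmapOn_of_notMem hu
  have hh : ∀ {a}, G.cmapOn U a = u ↔ a = u := by
    intro a
    conv_lhs => rw [← hcu, cmapOn_eq_iff hUV]
    simp [hu]
  have hV : (G.contractOn U S).V.erase u = (G.V.erase u).image (G.cmapOn U) := by
    ext x
    simp only [MGraph.contractOn, Finset.mem_erase, Finset.mem_image]
    constructor
    · rintro ⟨h, a, ha, rfl⟩
      exact ⟨a, ⟨fun h' => h (hh.2 h'), ha⟩, rfl⟩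
    · rintro ⟨a, ⟨h, ha⟩, rfl⟩
      exact ⟨fun h' => h (hh.1 h'), a, ha, rfl⟩
  refine ⟨h.loopless.contractOn hUV, h.econ.contractOn h.loopless hUV, ?_, ?_, ?_, ?_⟩
  · rw [← hcu]
    exact Finset.mem_image_of_mem _ h.mem
  · rw [hV]; exact h.nonempty.image _
  · rw [hV]; exact h.rest.contractOn h.loopless hUV
  · have hX : G.cmapOn U ⁻¹' {u} = ({u} : Set ℕ) := by
      ext a; simp [hh]
    refine h.deg.trans ?_
    conv_lhs => rw [← hX]
    exact Finset.card_le_card (cut_subset_contractOn h.loopless hUV _)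

/-- Contracting cycles away from the hub, we may assume that the rest of the graph is a tree. -/
theorem IsHubbed.exists_acyclic {u d : ℕ} (n : ℕ) : ∀ {G : MGraph}, G.V.card ≤ n →
    G.IsHubbed u d → ∃ H, G.CCMinor H ∧ H.IsHubbed u d ∧
      ∀ C ⊆ H.inner (H.V.erase u), ¬ H.IsCycleSet C := by
  induction n with
  | zero =>
    intro G hn h
    exact absurd (Finset.card_pos.2 ⟨u, h.mem⟩) (by omega)
  | succ n ih =>
    intro G hn h
    by_cases hac : ∀ C ⊆ G.inner (G.V.erase u), ¬ G.IsCycleSet C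
    · exact ⟨G, Relation.ReflTransGen.refl, h, hac⟩
    push Not at hac
    obtain ⟨C, hCs, hC⟩ := hac
    have hsub := vertsOf_subset_of_inner hCs
    obtain ⟨x, hx, y, hy, hxy⟩ := exists_two_vertsOf h.loopless hC
    have hlt : (G.contractCycle C).V.card < G.V.card :=
      card_image_cmapOn_lt vertsOf_subset vertsOf_subset hx hy hxy
    obtain ⟨H, hH⟩ := ih (G := G.contractCycle C) (by omega) (h.contractOn hsub)
    exact ⟨H, Relation.ReflTransGen.head ⟨C, hC, rfl⟩ hH.1, hH.2⟩

/-- The complement of a subtree of the tree is bridgeless. -/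
theorem IsHubbed.ECon_sdiff {u d : ℕ} (h : G.IsHubbed u d)
    (hac : ∀ C ⊆ G.inner (G.V.erase u), ¬ G.IsCycleSet C) {P : Finset ℕ}
    (hP : P ⊆ G.V.erase u) (hPc : G.ECon P 1) : G.ECon (G.V \ P) 2 := by
  have key : ∀ X : Set ℕ, ∀ z ∈ G.V \ P, z ∈ X → u ∉ X → 2 ≤ (G.cut (G.V \ P) X).card := by
    intro X z hz hzX huX
    by_contra hlt
    set A := (G.V \ P).filter (· ∈ X) with hA
    have hzA : z ∈ A := Finset.mem_filter.2 ⟨hz, hzX⟩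
    set Z := G.comp A z with hZ
    have hZA : Z ⊆ A := comp_subset
    have hAV : ∀ {v}, v ∈ A → v ∈ G.V ∧ v ∉ P ∧ v ∈ X := fun hv => by
      simpa [hA, and_assoc] using hv
    have huZ : u ∉ Z := fun h' => huX (hAV (hZA h')).2.2
    have h3 := h.econ Z z (Finset.mem_sdiff.1 hz).1 (self_mem_comp hzA) u h.mem huZ
    have h4 := Finset.le_card_sdiff (G.cut (G.V \ P) X) (G.cut G.V Z)
    obtain ⟨e₁, he₁, e₂, he₂, hne⟩ := Finset.one_lt_card.1
      (by omega : 1 < (G.cut G.V Z \ G.cut (G.V \ P) X).card)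
    have hD : ∀ e ∈ G.cut G.V Z \ G.cut (G.V \ P) X, e ∈ G.E ∧ ∃ c ∈ Z, ∃ d ∈ P,
        G.ends e = s(c, d) := by
      intro e he
      obtain ⟨he1, he2⟩ := Finset.mem_sdiff.1 he
      obtain ⟨heE, c, d, hcd, hc, hd, hcZ, hdZ⟩ := mem_cut.1 he1
      refine ⟨heE, c, hcZ, d, ?_, hcd⟩
      by_contra hdP
      have hcA := hAV (hZA hcZ)
      by_cases hdX : d ∈ X
      · exact hdZ (comp_closed heE hcd hcZ
          (Finset.mem_filter.2 ⟨Finset.mem_sdiff.2 ⟨hd, hdP⟩, hdX⟩))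
      · exact he2 (mem_cut.2 ⟨heE, c, d, hcd, Finset.mem_sdiff.2 ⟨hc, hcA.2.1⟩,
          Finset.mem_sdiff.2 ⟨hd, hdP⟩, hcA.2.2, hdX⟩)
    obtain ⟨hE₁, c₁, hc₁, d₁, hd₁, hcd₁⟩ := hD e₁ he₁
    obtain ⟨hE₂, c₂, hc₂, d₂, hd₂, hcd₂⟩ := hD e₂ he₂
    have hZT : Z ⊆ G.V.erase u := fun v hv =>
      Finset.mem_erase.2 ⟨fun h' => huZ (h' ▸ hv), (hAV (hZA hv)).1⟩
    have hin : ∀ {e c d}, e ∈ G.E → c ∈ Z → d ∈ P → G.ends e = s(c, d) →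
        e ∈ G.inner (G.V.erase u) := fun he hc hd h' =>
      (mem_inner h').2 ⟨he, hZT hc, hP hd⟩
    have hsub : ∀ {Q : Finset ℕ}, Q ⊆ G.V.erase u → (c₁ ∉ Q ∨ d₁ ∉ Q) →
        G.inner Q ⊆ (G.inner (G.V.erase u)).erase e₁ := by
      intro Q hQ hnot e he
      refine Finset.mem_erase.2 ⟨?_, inner_mono hQ he⟩
      rintro rfl
      have := (mem_inner hcd₁).1 he
      rcases hnot with h' | h'
      · exact h' this.2.1
      · exact h' this.2.2
    have hr1 := ((ECon_comp hzA).reachable hc₁ hc₂).mono (edgeGraph_mono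
      (hsub hZT (Or.inr fun h' => (hAV (hZA h')).2.1 hd₁)))
    have hr2 := (hPc.reachable hd₂ hd₁).mono (edgeGraph_mono
      (hsub hP (Or.inl fun h' => (hAV (hZA hc₁)).2.1 h')))
    have hr3 := reachable_of_edge (Finset.mem_erase.2 ⟨hne.symm, hin hE₂ hc₂ hd₂ hcd₂⟩) hcd₂
    obtain ⟨C, hC, hC'⟩ := exists_cycle h.loopless inner_subset (hin hE₁ hc₁ hd₁ hcd₁) hcd₁
      ((hr1.trans hr3).trans hr2)
    exact hac C hC hC'
  intro X a ha haX b hb hbX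
  by_cases hu : u ∈ X
  · rw [← cut_compl]
    exact key Xᶜ b hb hbX (by simpa using hu)
  · exact key X a ha haX hu

/-- Contracting the complement of a path of the tree yields a fan-type graph. -/
theorem IsHubbed.exists_fan {u d : ℕ} (h : G.IsHubbed u d)
    (hac : ∀ C ⊆ G.inner (G.V.erase u), ¬ G.IsCycleSet C) {n : ℕ} {f g : ℕ → ℕ}
    (hf : ∀ i ≤ n, ∀ j ≤ n, f i = f j → i = j) (hfT : ∀ i ≤ n, f i ∈ G.V.erase u)
    (hg : ∀ i < n, g i ∈ G.inner (G.V.erase u) ∧ G.ends (g i) = s(f i, f (i + 1))) :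
    ∃ H v vs pE S, G.CCMinor H ∧ IsFanType H v vs pE S ∧
      n + 1 ≤ ∑ w ∈ vs.toFinset, (S w).card ∧
      (n = 0 → (G.cut G.V {f 0}).card ≤ ∑ w ∈ vs.toFinset, (S w).card) := by
  set P : Finset ℕ := (Finset.range (n + 1)).image f with hPdef
  have hfP : ∀ {i}, i ≤ n → f i ∈ P := fun hi =>
    Finset.mem_image_of_mem _ (Finset.mem_range.2 (by omega))
  have hPf : ∀ {v}, v ∈ P → ∃ i ≤ n, f i = v := by
    intro v hv
    obtain ⟨i, hi, rfl⟩ := Finset.mem_image.1 hv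
    exact ⟨i, by simpa [Nat.lt_succ_iff] using hi, rfl⟩
  have hPT : P ⊆ G.V.erase u := by
    intro v hv
    obtain ⟨i, hi, rfl⟩ := hPf hv
    exact hfT i hi
  have hPV : P ⊆ G.V := hPT.trans (Finset.erase_subset _ _)
  have hPc : G.ECon P 1 := by
    apply ECon_one_of_reachable_from (r := f 0)
    intro v hv
    obtain ⟨i, hi, rfl⟩ := hPf hv
    exact reachable_of_seq (g := g) (Nat.zero_le i) fun k _ hk => ⟨(mem_inner (hg k (by omega)).2).2
      ⟨inner_subset (hg k (by omega)).1, hfP (by omega), hfP (by omega)⟩, (hg k (by omega)).2⟩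
  set U := G.V \ P with hUdef
  have hU : U ⊆ G.V := Finset.sdiff_subset
  have hne : U.Nonempty := ⟨u, Finset.mem_sdiff.2 ⟨h.mem, fun h' => by simpa using hPT h'⟩⟩
  have hPU : ∀ {v}, v ∈ P → v ∉ U := fun hv h' => (Finset.mem_sdiff.1 h').2 hv
  have hVP : ∀ {v}, v ∈ G.V → v ∉ U → v ∈ P := fun hv hv' => by
    by_contra hvP
    exact hv' (Finset.mem_sdiff.2 ⟨hv, hvP⟩)
  have hcP : ∀ {v}, v ∈ P → G.cmapOn U v = v := fun hv => cmapOn_of_notMem (hPU hv)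
  have hginj := edge_injective hf (fun i hi => (hg i hi).2)
  have hedge : ∀ e ∈ G.inner P, ∃ k < n, g k = e := by
    intro e he
    by_contra! hk
    obtain ⟨a, b, hab⟩ := G.exists_ends e
    obtain ⟨heE, ha, hb⟩ := (mem_inner hab).1 he
    obtain ⟨i, hi, rfl⟩ := hPf ha
    obtain ⟨j, hj, rfl⟩ := hPf hb
    have hr : ∀ i ≤ n, (G.edgeGraph ((G.inner (G.V.erase u)).erase e)).Reachable (f 0) (f i) :=
      fun i hi => reachable_of_seq (g := g) (Nat.zero_le i) fun k _ hk' =>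
        ⟨Finset.mem_erase.2 ⟨hk k (by omega), (hg k (by omega)).1⟩, (hg k (by omega)).2⟩
    obtain ⟨C, hC, hC'⟩ := exists_cycle h.loopless inner_subset (inner_mono hPT he) hab
      ((hr i hi).symm.trans (hr j hj))
    exact hac C hC hC'
  let S : ℕ → Finset ℕ := fun w => G.E.filter fun e => ∃ b ∈ U, G.ends e = s(w, b)
  have hS : ∀ {w e}, e ∈ S w ↔ e ∈ G.E ∧ ∃ b ∈ U, G.ends e = s(w, b) := by simp [S]
  have hSne : ∀ w ∈ P, (S w).Nonempty := by
    intro w hw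
    by_contra hempty
    rw [Finset.not_nonempty_iff_eq_empty] at hempty
    obtain ⟨i, hi, rfl⟩ := hPf hw
    have h3 := h.econ {f i} (f i) (hPV hw) rfl u h.mem (by
      rintro h'
      have := hPT hw
      rw [← Set.mem_singleton_iff.1 h'] at this
      simp at this)
    have hsub : G.cut G.V {f i} ⊆ {g (i - 1), g i} := by
      intro e he
      obtain ⟨heE, a, b, hab, ha, hb, hai, hbi⟩ := mem_cut.1 he
      rw [Set.mem_singleton_iff] at hai
      subst hai
      have hbU : b ∉ U := fun hbU => by
        have := hS.2 ⟨heE, b, hbU, hab⟩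
        simp [hempty] at this
      obtain ⟨k, hk, rfl⟩ := hedge e ((mem_inner hab).2 ⟨heE, hw, hVP hb hbU⟩)
      rw [(hg k hk).2, Sym2.eq_iff] at hab
      rcases hab with ⟨h', -⟩ | ⟨-, h'⟩
      · simp [hf _ hk.le _ hi h']
      · have := hf _ hk _ hi h'
        simp [← this]
    have := (Finset.card_le_card hsub).trans Finset.card_le_two
    omega
  have hvs : ((List.range (n + 1)).map f).toFinset = P := by
    ext v; simp [hPdef]
  have hsum : n + 1 ≤ ∑ w ∈ P, (S w).card := by
    have hcard : P.card = n + 1 := by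
      rw [hPdef, Finset.card_image_of_injOn, Finset.card_range]
      intro i hi j hj hij
      simp only [Finset.coe_range, Set.mem_Iio] at hi hj
      exact hf i (by omega) j (by omega) hij
    calc n + 1 = ∑ w ∈ P, 1 := by simp [hcard]
      _ ≤ _ := Finset.sum_le_sum fun w hw => Finset.card_pos.2 (hSne w hw)
  refine ⟨G.contractOn U ∅, G.hub U, (List.range (n + 1)).map f, (List.range n).map g, S,
    ccMinor_contractOn _ le_rfl h.loopless hU hne (h.ECon_sdiff hac hPT hPc), ?_, ?_, ?_⟩
  · refine ⟨by simp, ?_, ?_, ?_, by simp, ?_, ?_, ?_, ?_⟩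
    · refine List.Nodup.map_on ?_ List.nodup_range
      intro i hi j hj hij
      rw [List.mem_range] at hi hj
      exact hf i (by omega) j (by omega) hij
    · intro h'
      rw [← List.mem_toFinset, hvs] at h'
      exact hPU h' (hub_mem hU hne)
    · rw [hvs]
      ext x
      simp only [MGraph.contractOn, Finset.mem_image, Finset.mem_insert]
      constructor
      · rintro ⟨a, ha, rfl⟩
        by_cases haU : a ∈ U
        · exact Or.inl (cmapOn_of_mem hU haU)
        · rw [hcP (hVP ha haU)]; exact Or.inr (hVP ha haU)
      · rintro (rfl | hx)
        · have := hub_mem hU hne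
          exact ⟨_, hU this, cmapOn_of_mem hU this⟩
        · exact ⟨x, hPV hx, hcP hx⟩
    · refine List.Nodup.map_on ?_ List.nodup_range
      intro i hi j hj hij
      rw [List.mem_range] at hi hj
      exact hginj i hi j hj hij
    · intro i hi
      have hi' : i < n := by simpa using hi
      have e1 : ((List.range (n + 1)).map f)[i]! = f i := by
        rw [getElem!_pos _ _ (by simp; omega)]; simp
      have e2 : ((List.range (n + 1)).map f)[i + 1]! = f (i + 1) := by
        rw [getElem!_pos _ _ (by simp; omega)]; simp
      have e3 : ((List.range n).map g)[i]! = g i := by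
        rw [getElem!_pos _ _ (by simp; omega)]; simp
      rw [e1, e2, e3, contractOn_ends (hg i hi').2, hcP (hfP hi'.le), hcP (hfP hi'),
        mem_contractOn_E h.loopless (hg i hi').2]
      exact ⟨⟨inner_subset (hg i hi').1, fun h' => hPU (hfP hi'.le) h'.1⟩, rfl⟩
    · intro w hw
      rw [← List.mem_toFinset, hvs] at hw
      refine ⟨hSne w hw, fun e he => ?_⟩
      obtain ⟨heE, b, hb, hwb⟩ := hS.1 he
      rw [contractOn_ends hwb, mem_contractOn_E h.loopless hwb, hcP hw, cmapOn_of_mem hU hb]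
      exact ⟨⟨heE, fun h' => hPU hw h'.1⟩, Sym2.eq_swap⟩
    · rw [hvs]
      ext e
      obtain ⟨a, b, hab⟩ := G.exists_ends e
      rw [mem_contractOn_E h.loopless hab]
      simp only [Finset.mem_union, List.mem_toFinset, List.mem_map, List.mem_range,
        Finset.mem_biUnion]
      constructor
      · rintro ⟨heE, hnot⟩
        obtain ⟨ha, hb⟩ := mem_V_of_ends heE hab
        by_cases haU : a ∈ U
        · have hbU : b ∉ U := fun h' => hnot ⟨haU, h'⟩
          exact Or.inr ⟨b, hVP hb hbU, hS.2 ⟨heE, a, haU, hab.trans Sym2.eq_swap⟩⟩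
        · by_cases hbU : b ∈ U
          · exact Or.inr ⟨a, hVP ha haU, hS.2 ⟨heE, b, hbU, hab⟩⟩
          · exact Or.inl (hedge e ((mem_inner hab).2 ⟨heE, hVP ha haU, hVP hb hbU⟩))
      · rintro (⟨k, hk, rfl⟩ | ⟨w, hw, he⟩)
        · refine ⟨inner_subset (hg k hk).1, fun h' => ?_⟩
          have : f k ∈ G.ends (g k) := by simp [(hg k hk).2]
          rw [hab, Sym2.mem_iff] at this
          rcases this with h'' | h''
          · exact hPU (hfP hk.le) (h'' ▸ h'.1)
          · exact hPU (hfP hk.le) (h'' ▸ h'.2)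
        · obtain ⟨heE, c, hc, hwc⟩ := hS.1 he
          refine ⟨heE, fun h' => ?_⟩
          have : w ∈ G.ends e := by simp [hwc]
          rw [hab, Sym2.mem_iff] at this
          rcases this with rfl | rfl
          · exact hPU hw h'.1
          · exact hPU hw h'.2
  · rw [hvs]; exact hsum
  · intro hn
    subst hn
    rw [hvs]
    refine le_trans (Finset.card_le_card fun e he => ?_)
      (Finset.single_le_sum (f := fun w => (S w).card) (fun _ _ => Nat.zero_le _) (hfP le_rfl))
    obtain ⟨heE, a, b, hab, -, hb, ha0, hb0⟩ := mem_cut.1 he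
    rw [Set.mem_singleton_iff] at ha0 hb0
    subst ha0
    refine hS.2 ⟨heE, b, Finset.mem_sdiff.2 ⟨hb, fun hbP => ?_⟩, hab⟩
    obtain ⟨i, hi, rfl⟩ := hPf hbP
    obtain rfl : i = 0 := by omega
    exact hb0 rfl

/-- A hub of large degree yields a fan-type cc-minor with many spokes. -/
theorem IsHubbed.exists_fan_of_deg {u d t : ℕ} (h : G.IsHubbed u d)
    (hd : t * (t + 1) ^ t < d) :
    ∃ H v vs pE S, G.CCMinor H ∧ IsFanType H v vs pE S ∧
      t ≤ ∑ w ∈ vs.toFinset, (S w).card := by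
  obtain ⟨H, hGH, hH, hac⟩ := h.exists_acyclic _ le_rfl
  suffices hs : ∃ K v vs pE S, H.CCMinor K ∧ IsFanType K v vs pE S ∧
      t ≤ ∑ w ∈ vs.toFinset, (S w).card by
    obtain ⟨K, v, vs, pE, S, h1, h2⟩ := hs
    exact ⟨K, v, vs, pE, S, Relation.ReflTransGen.trans hGH h1, h2⟩
  by_cases hw : ∃ w ∈ H.V.erase u, t ≤ (H.cut H.V {w}).card
  · obtain ⟨w, hw, hwt⟩ := hw
    obtain ⟨K, v, vs, pE, S, h1, h2, -, h4⟩ := hH.exists_fan hac (n := 0) (f := fun _ => w)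
      (g := fun _ => 0) (fun i hi j hj _ => by omega) (fun _ _ => hw) (fun i hi => by omega)
    exact ⟨K, v, vs, pE, S, h1, h2, hwt.trans (h4 rfl)⟩
  · push Not at hw
    have hcard : (H.cut H.V {u}).card ≤ (H.V.erase u).card * t := by
      refine le_trans (Finset.card_le_card fun e he => ?_) (Finset.card_biUnion_le_card_mul
        (H.V.erase u) (fun w => H.cut H.V {w}) t fun w hw' => (hw w hw').le)
      obtain ⟨heE, a, b, hab, ha, hb, hau, hbu⟩ := mem_cut.1 he
      rw [Set.mem_singleton_iff] at hau hbu
      refine Finset.mem_biUnion.2 ⟨b, Finset.mem_erase.2 ⟨hbu, hb⟩, mem_cut.2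
        ⟨heE, b, a, hab.trans Sym2.eq_swap, hb, ha, rfl, ?_⟩⟩
      rintro h'
      exact hbu (h' ▸ hau)
    have hbig : (t + 1) ^ t < (H.V.erase u).card := by
      have := hd.trans_le (hH.deg.trans hcard)
      rw [mul_comm] at this
      exact lt_of_mul_lt_mul_right this (Nat.zero_le t)
    obtain ⟨a, ha⟩ := hH.nonempty
    obtain ⟨y, hy, hfar⟩ := exists_far (G := H) (a := a) (fun v hv => (Finset.card_le_card
      (cut_subset_cut (Finset.erase_subset u H.V) {v})).trans (hw v hv).le) hbig
    obtain ⟨n, f, g, hf0, hfn, hf, hg, p, hp⟩ := exists_path (hH.rest.reachable ha hy)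
    have hn := hfar p
    have hfT : ∀ i ≤ n, f i ∈ H.V.erase u := by
      intro i hi
      by_cases hin : i < n
      · exact ((mem_inner (hg i hin).2).1 (hg i hin).1).2.1
      · obtain rfl : i = n := by omega
        rwa [hfn]
    obtain ⟨K, v, vs, pE, S, h1, h2, h3, -⟩ := hH.exists_fan hac hf hfT hg
    exact ⟨K, v, vs, pE, S, h1, h2, by omega⟩

end MGraph

namespace MGraph

variable {G : MGraph} {S T U W K : Finset ℕ}

theorem Adj.symm' {a b : ℕ} (h : G.Adj a b) : G.Adj b a := by
  obtain ⟨e, he, h'⟩ := h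
  exact ⟨e, he, h'.trans Sym2.eq_swap⟩

theorem Adj.mem_right {a b : ℕ} (h : G.Adj a b) : b ∈ G.V := by
  obtain ⟨e, he, h'⟩ := h
  exact (mem_V_of_ends he h').2

theorem Adj.reachable {a b : ℕ} (h : G.Adj a b) (ha : a ∈ S) (hb : b ∈ S) :
    (G.edgeGraph (G.inner S)).Reachable a b := by
  obtain ⟨e, he, hab⟩ := h
  exact reachable_of_edge ((mem_inner hab).2 ⟨he, ha, hb⟩) hab

/-- The complement of a component of the complement of a bridgeless subgraph is bridgeless. -/
theorem ECon_two_of_closed (h3 : G.ECon G.V 3) (hW : W ⊆ G.V) (hW2 : G.ECon W 2)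
    (hKW : K ⊆ G.V \ W)
    (hcl : ∀ e c d, e ∈ G.E → G.ends e = s(c, d) → c ∈ K → d ∈ G.V \ W → d ∈ K) :
    G.ECon (G.V \ K) 2 := by
  have hWK : W ⊆ G.V \ K := fun w hw =>
    Finset.mem_sdiff.2 ⟨hW hw, fun h => (Finset.mem_sdiff.1 (hKW h)).2 hw⟩
  have key : ∀ X : Set ℕ, ∀ a ∈ G.V \ K, a ∈ X → ∀ b ∈ G.V \ K, b ∉ X → (∀ w ∈ W, w ∉ X) →
      2 ≤ (G.cut (G.V \ K) X).card := by
    intro X a ha haX b hb hbX hWX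
    have h := h3 {v | v ∈ X ∧ v ∈ G.V \ K} a (Finset.mem_sdiff.1 ha).1 ⟨haX, ha⟩
      b (Finset.mem_sdiff.1 hb).1 (fun h' => hbX h'.1)
    refine le_trans (by omega) (h.trans (Finset.card_le_card fun e he => ?_))
    obtain ⟨heE, c, d, hcd, hc, hd, hcX, hdX⟩ := mem_cut.1 he
    have hdK : d ∉ K := fun hdK => (Finset.mem_sdiff.1 hcX.2).2
      (hcl e d c heE (hcd.trans Sym2.eq_swap) hdK
        (Finset.mem_sdiff.2 ⟨hc, fun hcW => hWX c hcW hcX.1⟩))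
    have hd' := Finset.mem_sdiff.2 ⟨hd, hdK⟩
    exact mem_cut.2 ⟨heE, c, d, hcd, hcX.2, hd', hcX.1, fun h' => hdX ⟨h', hd'⟩⟩
  intro X a ha haX b hb hbX
  by_cases h1 : ∀ w ∈ W, w ∉ X
  · exact key X a ha haX b hb hbX h1
  by_cases h2 : ∀ w ∈ W, w ∈ X
  · rw [← cut_compl]
    exact key Xᶜ b hb hbX a ha (by simpa using haX) (by simpa using h2)
  push Not at h1 h2
  obtain ⟨w, hw, hwX⟩ := h1
  obtain ⟨w', hw', hwX'⟩ := h2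
  exact (hW2 X w hw hwX w' hw' hwX').trans (Finset.card_le_card (cut_subset_cut hWK X))

theorem exists_switch {X : Set ℕ} {f : ℕ → ℕ} {i j : ℕ} (hij : i ≤ j)
    (h : ¬ (f i ∈ X ↔ f j ∈ X)) :
    ∃ k, i ≤ k ∧ k < j ∧ ¬ (f k ∈ X ↔ f (k + 1) ∈ X) := by
  by_contra! hk
  refine h ?_
  induction j, hij using Nat.le_induction with
  | base => rfl
  | succ j hij ih =>
    have := hk j hij (by omega)
    by_cases h' : f i ∈ X ↔ f j ∈ X
    · exact h'.trans this
    · exact absurd (ih h' fun k h1 h2 => hk k h1 (by omega)) h'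

theorem mem_cut_of_switch {X : Set ℕ} {e a b : ℕ} (he : e ∈ G.E) (h : G.ends e = s(a, b))
    (ha : a ∈ W) (hb : b ∈ W) (hX : ¬ (a ∈ X ↔ b ∈ X)) : e ∈ G.cut W X := by
  by_cases haX : a ∈ X
  · exact mem_cut.2 ⟨he, a, b, h, ha, hb, haX, fun hbX => hX (by simp [haX, hbX])⟩
  · exact mem_cut.2 ⟨he, b, a, h.trans Sym2.eq_swap, hb, ha,
      by by_contra hbX; exact hX (by simp [haX, hbX]), haX⟩

theorem two_le_card_cut {X : Set ℕ} {n : ℕ} {f g : ℕ → ℕ}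
    (hf : ∀ i ≤ n, ∀ j ≤ n, f i = f j → i = j)
    (hg : ∀ i < n, g i ∈ G.E ∧ G.ends (g i) = s(f i, f (i + 1))) (hfW : ∀ i ≤ n, f i ∈ W)
    (h : f 0 ∈ X ↔ f n ∈ X) {i : ℕ} (hi : i ≤ n) (hiX : ¬ (f 0 ∈ X ↔ f i ∈ X)) :
    2 ≤ (G.cut W X).card := by
  obtain ⟨k, -, hk, hkX⟩ := exists_switch (Nat.zero_le i) hiX
  obtain ⟨l, hil, hl, hlX⟩ := exists_switch hi (fun h' => hiX (h.trans h'.symm))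
  refine Finset.one_lt_card.2 ⟨g k, ?_, g l, ?_, fun h' => ?_⟩
  · exact mem_cut_of_switch (hg k (by omega)).1 (hg k (by omega)).2 (hfW _ (by omega))
      (hfW _ (by omega)) hkX
  · exact mem_cut_of_switch (hg l hl).1 (hg l hl).2 (hfW _ (by omega)) (hfW _ (by omega)) hlX
  · have := edge_injective hf (fun i hi => (hg i hi).2) k (by omega) l hl h'
    omega

/-- A connected vertex set avoiding `x` and `y` but adjacent to both. -/
structure IsSide (G : MGraph) (x y : ℕ) (A : Finset ℕ) : Prop where
  subset : A ⊆ G.V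
  left : x ∉ A
  right : y ∉ A
  econ : G.ECon A 1
  adj_left : ∃ a ∈ A, G.Adj a x
  adj_right : ∃ a ∈ A, G.Adj a y

theorem IsSide.insert_adj {x y a v : ℕ} {A : Finset ℕ} (h : G.IsSide x y A) (ha : a ∈ A)
    (hav : G.Adj a v) (hx : v ≠ x) (hy : v ≠ y) : G.IsSide x y (insert v A) where
  subset := Finset.insert_subset hav.mem_right h.subset
  left := by simp [hx.symm, h.left]
  right := by simp [hy.symm, h.right]
  econ := h.econ.insert ha hav
  adj_left := by
    obtain ⟨b, hb, h'⟩ := h.adj_left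
    exact ⟨b, Finset.mem_insert_of_mem hb, h'⟩
  adj_right := by
    obtain ⟨b, hb, hby⟩ := h.adj_right
    exact ⟨b, Finset.mem_insert_of_mem hb, hby⟩

/-- `U` is contractible to a vertex of degree at least `d`, and its complement is connected. -/
structure IsContractible (G : MGraph) (d : ℕ) (U : Finset ℕ) : Prop where
  subset : U ⊆ G.V
  nonempty : U.Nonempty
  nonempty_compl : (G.V \ U).Nonempty
  econ : G.ECon U 2
  econ_compl : G.ECon (G.V \ U) 1
  deg : d ≤ (G.cut G.V U).card

/-- Given an `x`-`y` path and a side `B` closing it to a cycle, another side `A` of the path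
can be separated by a large cut if it has many neighbours on the path. -/
theorem IsSide.exists_contractible (hG : G.Loopless) (h3 : G.ECon G.V 3) {x y : ℕ}
    (hxV : x ∈ G.V) (hxy : ¬ G.Adj x y)
    {A B N : Finset ℕ} (hA : G.IsSide x y A) (hB : G.IsSide x y B) (hAB : Disjoint A B)
    {n : ℕ} {f g : ℕ → ℕ} (hf0 : f 0 = x) (hfn : f n = y)
    (hf : ∀ i ≤ n, ∀ j ≤ n, f i = f j → i = j)
    (hg : ∀ i < n, g i ∈ G.E ∧ G.ends (g i) = s(f i, f (i + 1)))
    (hfA : ∀ i ≤ n, f i ∉ A) (hfB : ∀ i ≤ n, f i ∉ B)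
    (hN : ∀ w ∈ N, (∃ i ≤ n, f i = w) ∧ ∃ a ∈ A, G.Adj a w) :
    ∃ U, G.IsContractible N.card U := by
  obtain ⟨m, f', g', hf0', hfm', hf', hg', -⟩ : ∃ (m : ℕ) (f' : ℕ → ℕ) (g' : ℕ → ℕ),
      f' 0 = x ∧ f' m = y ∧ (∀ i ≤ m, ∀ j ≤ m, f' i = f' j → i = j) ∧
      (∀ i < m, g' i ∈ G.inner (insert x (insert y B)) ∧
        G.ends (g' i) = s(f' i, f' (i + 1))) ∧ _ := by
    obtain ⟨b, hb, hbx⟩ := hB.adj_left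
    obtain ⟨c, hc, hcy⟩ := hB.adj_right
    refine exists_path ((hbx.symm'.reachable (b := b) ?_ ?_).trans ((SimpleGraph.Reachable.mono
      (edgeGraph_mono (inner_mono ?_)) (hB.econ.reachable hb hc)).trans (hcy.reachable ?_ ?_)))
    · simp
    · simp [hb]
    · exact fun v hv => by simp [hv]
    · simp [hc]
    · simp
  have hfV : ∀ i ≤ n, f i ∈ G.V := by
    intro i hi
    by_cases h : i = 0
    · rw [h, hf0]; exact hxV
    · have := mem_V_of_ends (hg (i - 1) (by omega)).1 (hg (i - 1) (by omega)).2
      rw [show i - 1 + 1 = i by omega] at this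
      exact this.2
  have hfS' : ∀ i ≤ m, f' i = x ∨ f' i = y ∨ f' i ∈ B := by
    intro i hi
    by_cases h : i = m
    · rw [h, hfm']; simp
    · have := (mem_inner (hg' i (by omega)).2).1 (hg' i (by omega)).1
      simpa using this.2.1
  have hyV : y ∈ G.V := hfn ▸ hfV n le_rfl
  set W := (Finset.range (n + 1)).image f ∪ (Finset.range (m + 1)).image f' with hWdef
  have hmemW : ∀ {v}, v ∈ W ↔ (∃ i ≤ n, f i = v) ∨ ∃ i ≤ m, f' i = v := by
    intro v
    simp [hWdef]
  have hfW : ∀ i ≤ n, f i ∈ W := fun i hi => hmemW.2 (Or.inl ⟨i, hi, rfl⟩)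
  have hfW' : ∀ i ≤ m, f' i ∈ W := fun i hi => hmemW.2 (Or.inr ⟨i, hi, rfl⟩)
  have hgE' : ∀ i < m, g' i ∈ G.E ∧ G.ends (g' i) = s(f' i, f' (i + 1)) := fun i hi =>
    ⟨inner_subset (hg' i hi).1, (hg' i hi).2⟩
  have hWV : W ⊆ G.V := by
    intro v hv
    rcases hmemW.1 hv with ⟨i, hi, rfl⟩ | ⟨i, hi, rfl⟩
    · exact hfV i hi
    · rcases hfS' i hi with h | h | h
      · rwa [h]
      · rwa [h]
      · exact hB.subset h
  have hW2 : G.ECon W 2 := by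
    intro X a ha haX b hb hbX
    by_cases hX : x ∈ X ↔ y ∈ X
    · obtain ⟨z, hz, hzX⟩ : ∃ z ∈ W, ¬ (x ∈ X ↔ z ∈ X) := by
        by_cases hx : x ∈ X
        · exact ⟨b, hb, by simp [hx, hbX]⟩
        · exact ⟨a, ha, by simp [hx, haX]⟩
      rcases hmemW.1 hz with ⟨i, hi, rfl⟩ | ⟨i, hi, rfl⟩
      · exact two_le_card_cut hf hg hfW (by rwa [hf0, hfn]) hi (by rwa [hf0])
      · exact two_le_card_cut hf' hgE' hfW' (by rwa [hf0', hfm']) hi (by rwa [hf0'])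
    · obtain ⟨k, -, hk, hkX⟩ := exists_switch (f := f) (Nat.zero_le n) (by rwa [hf0, hfn])
      obtain ⟨l, -, hl, hlX⟩ := exists_switch (f := f') (Nat.zero_le m) (by rwa [hf0', hfm'])
      refine Finset.one_lt_card.2 ⟨g k, ?_, g' l, ?_, fun h' => ?_⟩
      · exact mem_cut_of_switch (hg k hk).1 (hg k hk).2 (hfW _ hk.le) (hfW _ hk) hkX
      · exact mem_cut_of_switch (hgE' l hl).1 (hgE' l hl).2 (hfW' _ hl.le) (hfW' _ hl) hlX
      · have hends := (hg k hk).2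
        have hin := (hg' l hl).1
        rw [← h', mem_inner hends] at hin
        have hxy' : ∀ {i}, i ≤ n → f i ∈ insert x (insert y B) → f i = x ∨ f i = y :=
          fun {i} hi h => by simpa [hfB i hi] using h
        have hne := hG.ne hin.1 hends
        rcases hxy' hk.le hin.2.1 with h1 | h1 <;> rcases hxy' hk hin.2.2 with h2 | h2
        · exact hne (h1.trans h2.symm)
        · exact hxy ⟨_, hin.1, by rw [hends, h1, h2]⟩
        · exact hxy ⟨_, hin.1, by rw [hends, h1, h2, Sym2.eq_swap]⟩
        · exact hne (h1.trans h2.symm)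
  have hAW : A ⊆ G.V \ W := by
    intro a ha
    refine Finset.mem_sdiff.2 ⟨hA.subset ha, fun haW => ?_⟩
    rcases hmemW.1 haW with ⟨i, hi, rfl⟩ | ⟨i, hi, rfl⟩
    · exact hfA i hi ha
    · rcases hfS' i hi with h | h | h
      · exact hA.left (h ▸ ha)
      · exact hA.right (h ▸ ha)
      · exact Finset.disjoint_left.1 hAB ha h
  obtain ⟨a, ha, -⟩ := hA.adj_left
  set K := G.comp (G.V \ W) a with hK
  have hAK : A ⊆ K := subset_comp hA.econ hAW ha
  have hKW : K ⊆ G.V \ W := comp_subset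
  have hKV : K ⊆ G.V := hKW.trans Finset.sdiff_subset
  have hWK : ∀ {w}, w ∈ W → w ∉ K := fun hw h => (Finset.mem_sdiff.1 (hKW h)).2 hw
  have hVK : G.V \ (G.V \ K) = K := Finset.sdiff_sdiff_eq_self hKV
  refine ⟨G.V \ K, Finset.sdiff_subset, ⟨x, Finset.mem_sdiff.2 ⟨hxV, hWK ?_⟩⟩, ?_,
    ECon_two_of_closed h3 hWV hW2 hKW fun e c d he h hc hd => comp_closed he h hc hd, ?_, ?_⟩
  · exact hf0 ▸ hfW 0 (Nat.zero_le n)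
  · rw [hVK]; exact ⟨a, hAK ha⟩
  · rw [hVK]; exact ECon_comp (hAW ha)
  · refine card_le_of_edges (G := G) (K := K) fun w hw => ?_
    obtain ⟨⟨i, hi, rfl⟩, z, hz, e, he, h⟩ := hN w hw
    refine ⟨hWK (hfW i hi), e, ?_, z, hAK hz, h.trans Sym2.eq_swap⟩
    exact mem_cut.2 ⟨he, f i, z, h.trans Sym2.eq_swap, hfV i hi, hA.subset hz,
      Finset.mem_sdiff.2 ⟨hfV i hi, hWK (hfW i hi)⟩,
      fun h' => (Finset.mem_sdiff.1 h').2 (hAK hz)⟩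

/-- Two far apart vertices joined by two sides and a path avoiding them give a large cut. -/
theorem exists_contractible_of_far (hG : G.Loopless) (h3 : G.ECon G.V 3)
    (hvc : ∀ s₁ s₂, G.ECon (G.V \ {s₁, s₂}) 1) {x y d : ℕ} (hx : x ∈ G.V)
    (hxy : ¬ G.Adj x y)
    (hfar : ∀ p : (G.edgeGraph (G.inner G.V)).Walk x y, 2 * d < p.length)
    {A₀ B₀ : Finset ℕ} (hA₀ : G.IsSide x y A₀) (hB₀ : G.IsSide x y B₀) (hAB₀ : Disjoint A₀ B₀)
    (hr₀ : (G.edgeGraph (G.inner (G.V \ (A₀ ∪ B₀)))).Reachable x y) :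
    ∃ U, G.IsContractible d U := by
  by_contra hno
  let good : Finset ℕ × Finset ℕ → Prop := fun p => G.IsSide x y p.1 ∧ G.IsSide x y p.2 ∧
    Disjoint p.1 p.2 ∧ (G.edgeGraph (G.inner (G.V \ (p.1 ∪ p.2)))).Reachable x y
  have hmem : ∀ {p}, p ∈ (G.V.powerset ×ˢ G.V.powerset).filter good ↔ good p := by
    intro p
    rw [Finset.mem_filter, Finset.mem_product, Finset.mem_powerset, Finset.mem_powerset]
    exact ⟨fun h => h.2, fun h => ⟨⟨h.1.subset, h.2.1.subset⟩, h⟩⟩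
  obtain ⟨⟨A, B⟩, hgood, hmax⟩ := Finset.exists_max_image
    ((G.V.powerset ×ˢ G.V.powerset).filter good) (fun p => p.1.card + p.2.card)
    ⟨(A₀, B₀), hmem.2 ⟨hA₀, hB₀, hAB₀, hr₀⟩⟩
  obtain ⟨hA, hB, hAB, hr⟩ := hmem.1 hgood
  simp only at hA hB hAB hr hmax
  set R := G.V \ (A ∪ B) with hR
  have hRA : ∀ {v}, v ∈ R → v ∉ A := fun hv h => (Finset.mem_sdiff.1 hv).2 (by simp [h])
  have hRB : ∀ {v}, v ∈ R → v ∉ B := fun hv h => (Finset.mem_sdiff.1 hv).2 (by simp [h])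
  let Nb : ℕ → Prop := fun v => ∃ c ∈ A ∪ B, G.Adj c v
  have hsep : ∀ v ∈ R, v ≠ x → v ≠ y → Nb v →
      ¬ (G.edgeGraph (G.inner (R.erase v))).Reachable x y := by
    rintro v hv hvx hvy ⟨c, hc, hcv⟩ hreach
    rcases Finset.mem_union.1 hc with hc | hc
    · have := hmax (insert v A, B) (hmem.2 ⟨hA.insert_adj hc hcv hvx hvy, hB,
        Finset.disjoint_insert_left.2 ⟨hRB hv, hAB⟩, by
          simp only [Finset.insert_union, Finset.sdiff_insert]
          exact hreach⟩)
      simp only [Finset.card_insert_of_notMem (hRA hv)] at this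
      omega
    · have := hmax (A, insert v B) (hmem.2 ⟨hA, hB.insert_adj hc hcv hvx hvy,
        Finset.disjoint_insert_right.2 ⟨hRA hv, hAB⟩, by
          simp only [Finset.union_insert, Finset.sdiff_insert]
          exact hreach⟩)
      simp only [Finset.card_insert_of_notMem (hRB hv)] at this
      omega
  obtain ⟨n, f, g, hf0, hfn, hf, hg, p, hp⟩ := exists_path hr
  have hn : 2 * d < n := by
    have := hfar (p.mapLe (edgeGraph_mono (inner_mono Finset.sdiff_subset)))
    simpa [hp] using this
  have hxR : x ∈ R := by
    simp [hR, hx, hA.left, hB.left]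
  have hfR : ∀ i ≤ n, f i ∈ R := fun i hi => by
    have := reachable_of_seq (G := G) (F := G.inner R) (Nat.zero_le i) fun k _ hk =>
      hg k (by omega)
    rw [hf0] at this
    exact mem_of_reachable this hxR
  have hgE : ∀ i < n, g i ∈ G.E ∧ G.ends (g i) = s(f i, f (i + 1)) := fun i hi =>
    ⟨inner_subset (hg i hi).1, (hg i hi).2⟩
  have hNb : ∃ i, 0 < i ∧ i < n ∧ ¬ Nb (f i) := by
    by_contra! hall
    have hall' : ∀ i ≤ n, Nb (f i) := by
      intro i hi
      rcases Nat.eq_zero_or_pos i with rfl | h0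
      · obtain ⟨c, hc, h⟩ := hA.adj_left
        exact ⟨c, Finset.mem_union_left _ hc, hf0 ▸ h⟩
      · rcases hi.lt_or_eq with h | rfl
        · exact hall i h0 h
        · obtain ⟨c, hc, h⟩ := hA.adj_right
          exact ⟨c, Finset.mem_union_left _ hc, hfn ▸ h⟩
    set P := (Finset.range (n + 1)).image f with hP
    have hPf : ∀ {v}, v ∈ P → ∃ i ≤ n, f i = v := by
      intro v hv
      simpa [hP, Nat.lt_succ_iff] using hv
    have hPcard : P.card = n + 1 := by
      rw [hP, Finset.card_image_of_injOn, Finset.card_range]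
      intro i hi j hj hij
      simp only [Finset.coe_range, Set.mem_Iio] at hi hj
      exact hf i (by omega) j (by omega) hij
    have hNA : (P.filter fun v => ∃ c ∈ A, G.Adj c v).card < d := by
      by_contra! h
      obtain ⟨U, hU⟩ := hA.exists_contractible hG h3 hx hxy hB hAB hf0 hfn hf hgE
        (fun i hi => hRA (hfR i hi)) (fun i hi => hRB (hfR i hi))
        (N := P.filter fun v => ∃ c ∈ A, G.Adj c v) fun w hw =>
          ⟨hPf (Finset.mem_filter.1 hw).1, (Finset.mem_filter.1 hw).2⟩
      exact hno ⟨U, { hU with deg := h.trans hU.deg }⟩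
    have hNB : (P.filter fun v => ∃ c ∈ B, G.Adj c v).card < d := by
      by_contra! h
      obtain ⟨U, hU⟩ := hB.exists_contractible hG h3 hx hxy hA hAB.symm hf0 hfn hf hgE
        (fun i hi => hRB (hfR i hi)) (fun i hi => hRA (hfR i hi))
        (N := P.filter fun v => ∃ c ∈ B, G.Adj c v) fun w hw =>
          ⟨hPf (Finset.mem_filter.1 hw).1, (Finset.mem_filter.1 hw).2⟩
      exact hno ⟨U, { hU with deg := h.trans hU.deg }⟩
    have hsub : P ⊆ (P.filter fun v => ∃ c ∈ A, G.Adj c v) ∪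
        P.filter fun v => ∃ c ∈ B, G.Adj c v := by
      intro v hv
      obtain ⟨i, hi, rfl⟩ := hPf hv
      obtain ⟨c, hc, h⟩ := hall' i hi
      rcases Finset.mem_union.1 hc with hc | hc
      · exact Finset.mem_union_left _ (Finset.mem_filter.2 ⟨hv, c, hc, h⟩)
      · exact Finset.mem_union_right _ (Finset.mem_filter.2 ⟨hv, c, hc, h⟩)
    have := (Finset.card_le_card hsub).trans (Finset.card_union_le _ _)
    omega
  obtain ⟨i, hi0, hin, hi⟩ := hNb
  have hNb0 : Nb (f 0) := by
    obtain ⟨c, hc, h⟩ := hA.adj_left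
    exact ⟨c, Finset.mem_union_left _ hc, hf0 ▸ h⟩
  have hNbn : Nb (f n) := by
    obtain ⟨c, hc, h⟩ := hA.adj_right
    exact ⟨c, Finset.mem_union_left _ hc, hfn ▸ h⟩
  obtain ⟨j₁, hj₁, hmax₁⟩ := Finset.exists_max_image ((Finset.range i).filter fun j => Nb (f j)) id
    ⟨0, Finset.mem_filter.2 ⟨Finset.mem_range.2 hi0, hNb0⟩⟩
  obtain ⟨j₂, hj₂, hmin₂⟩ := Finset.exists_min_image
    ((Finset.range (n + 1)).filter fun j => i < j ∧ Nb (f j)) id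
    ⟨n, Finset.mem_filter.2 ⟨Finset.mem_range.2 (by omega), hin, hNbn⟩⟩
  simp only [Finset.mem_filter, Finset.mem_range, id] at hj₁ hj₂ hmax₁ hmin₂
  have hgap : ∀ k, j₁ < k → k < j₂ → ¬ Nb (f k) := by
    intro k h1 h2 hk
    rcases lt_trichotomy k i with h | rfl | h
    · have := hmax₁ k ⟨h, hk⟩; omega
    · exact hi hk
    · have := hmin₂ k ⟨by omega, h, hk⟩; omega
  have hne : ∀ {k l}, k ≤ n → l ≤ n → k ≠ l → f k ≠ f l := fun hk hl h h' => h (hf _ hk _ hl h')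
  have hseq : ∀ {k l m}, k ≤ l → l ≤ n → m ≤ n → (m < k ∨ l < m) →
      (G.edgeGraph (G.inner (R.erase (f m)))).Reachable (f k) (f l) := by
    intro k l m hkl hl hm hml
    refine reachable_of_seq (g := g) hkl fun q h1 h2 => ⟨?_, (hg q (by omega)).2⟩
    refine (mem_inner (hg q (by omega)).2).2 ⟨(hgE q (by omega)).1, ?_, ?_⟩
    · exact Finset.mem_erase.2 ⟨hne (by omega) hm (by omega), hfR _ (by omega)⟩
    · exact Finset.mem_erase.2 ⟨hne (by omega) hm (by omega), hfR _ (by omega)⟩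
  obtain ⟨a, ha, -⟩ := hA.adj_left
  have haS : ∀ {k}, k ≤ n → a ≠ f k := fun hk h => hRA (hfR _ hk) (h ▸ ha)
  have hfiS : f i ∈ G.V \ {f j₁, f j₂} := by
    refine Finset.mem_sdiff.2 ⟨(Finset.mem_sdiff.1 (hfR i hin.le)).1, ?_⟩
    simp [hne hin.le (by omega : j₁ ≤ n) (by omega), hne hin.le (by omega : j₂ ≤ n) (by omega)]
  have haS' : a ∈ G.V \ {f j₁, f j₂} := by
    refine Finset.mem_sdiff.2 ⟨hA.subset ha, ?_⟩
    simp [haS (by omega : j₁ ≤ n), haS (by omega : j₂ ≤ n)]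
  set R' := R \ {f j₁, f j₂} with hR'
  have hfiR' : f i ∈ R' :=
    Finset.mem_sdiff.2 ⟨hfR i hin.le, (Finset.mem_sdiff.1 hfiS).2⟩
  obtain ⟨e, he, c, d', hcd, hc, hd'⟩ := exists_crossing ((hvc (f j₁) (f j₂)).reachable hfiS haS')
    {v | v ∈ G.comp R' (f i)} (self_mem_comp hfiR')
    (fun h => hRA (Finset.mem_sdiff.1 (comp_subset h)).1 ha)
  obtain ⟨heE, -, hdS⟩ := (mem_inner hcd).1 he
  have hcR' : c ∈ R' := comp_subset hc
  have hcS : c ≠ f j₁ ∧ c ≠ f j₂ := by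
    simpa using (Finset.mem_sdiff.1 hcR').2
  have hcR : c ∈ R := (Finset.mem_sdiff.1 hcR').1
  have hreach : (G.edgeGraph (G.inner R')).Reachable (f i) c := (Finset.mem_filter.1 hc).2
  have hdAB : d' ∈ A ∪ B := by
    by_contra h
    refine hd' (comp_closed heE hcd hc (Finset.mem_sdiff.2 ⟨Finset.mem_sdiff.2
      ⟨(Finset.mem_sdiff.1 hdS).1, h⟩, (Finset.mem_sdiff.1 hdS).2⟩))
  have hcNb : Nb c := ⟨d', hdAB, e, heE, hcd.trans Sym2.eq_swap⟩
  obtain ⟨k, hk, rfl⟩ : ∃ k ≤ n, f k = c := by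
    by_contra! hall
    refine hsep c hcR (fun h => hall 0 (by omega) (hf0.trans h.symm))
      (fun h => hall n le_rfl (hfn.trans h.symm)) hcNb ?_
    rw [← hf0, ← hfn]
    refine reachable_of_seq (g := g) (Nat.zero_le n) fun q _ h2 => ⟨?_, (hg q h2).2⟩
    exact (mem_inner (hg q h2).2).2 ⟨(hgE q h2).1,
      Finset.mem_erase.2 ⟨hall q (by omega), hfR q (by omega)⟩,
      Finset.mem_erase.2 ⟨hall (q + 1) (by omega), hfR (q + 1) (by omega)⟩⟩
  have hk₁ : k ≠ j₁ := fun h => hcS.1 (by rw [h])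
  have hk₂ : k ≠ j₂ := fun h => hcS.2 (by rw [h])
  have hkout : k < j₁ ∨ j₂ < k := by
    by_contra! h
    exact hgap k (by omega) (by omega) hcNb
  have hR'sub : ∀ {v}, (v = f j₁ ∨ v = f j₂) → R' ⊆ R.erase v := by
    intro v hv w hw
    obtain ⟨h1, h2⟩ := Finset.mem_sdiff.1 hw
    refine Finset.mem_erase.2 ⟨?_, h1⟩
    rintro rfl
    exact h2 (by simpa using hv)
  rcases hkout with hlt | hlt
  · refine hsep (f j₁) (hfR _ (by omega)) (hf0 ▸ hne (by omega) (by omega) (by omega))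
      (hfn ▸ hne (by omega) (by omega) (by omega)) hj₁.2 ?_
    have h1 := hseq (Nat.zero_le k) hk (by omega : j₁ ≤ n) (Or.inr hlt)
    have h2 := hreach.mono (edgeGraph_mono (inner_mono (hR'sub (Or.inl rfl))))
    have h3 := hseq hin.le le_rfl (by omega : j₁ ≤ n) (Or.inl hj₁.1)
    rw [hf0] at h1
    rw [hfn] at h3
    exact (h1.trans h2.symm).trans h3
  · refine hsep (f j₂) (hfR _ (by omega)) (hf0 ▸ hne (by omega) (by omega) (by omega))
      (hfn ▸ hne (by omega) (by omega) (by omega)) hj₂.2.2 ?_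
    have h1 := hseq (Nat.zero_le i) hin.le (by omega : j₂ ≤ n) (Or.inr hj₂.2.1)
    have h2 := hreach.mono (edgeGraph_mono (inner_mono (hR'sub (Or.inr rfl))))
    have h3 := hseq hk le_rfl (by omega : j₂ ≤ n) (Or.inl hlt)
    rw [hf0] at h1
    rw [hfn] at h3
    exact (h1.trans h2).trans h3

end MGraph

namespace MGraph

variable {G : MGraph} {S : Finset ℕ} {vs es : List ℕ} {x y : ℕ}

theorem IsWalk.mem_V (h : G.IsWalk vs es) : ∀ v ∈ vs, v ∈ G.V := by
  induction h with
  | nil hv => simpa using hv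
  | cons he hends hw ih =>
    intro v hv
    rcases List.mem_cons.1 hv with rfl | hv
    · exact (mem_V_of_ends he hends).1
    · exact ih v hv

theorem IsWalk.isChain (h : G.IsWalk vs es) : vs.IsChain G.Adj := by
  induction h with
  | nil hv => simp
  | cons he hends hw ih => exact List.isChain_cons_cons.2 ⟨⟨_, he, hends⟩, ih⟩

theorem IsWalk.exists_crossing (h : G.IsWalk vs es) {X : Set ℕ} (hx : vs.head? = some x)
    (hxX : x ∈ X) (hy : vs.getLast? = some y) (hyX : y ∉ X) :
    ∃ e ∈ es, e ∈ G.cut G.V X := by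
  induction h generalizing x with
  | nil hv =>
    simp only [List.head?_cons, List.getLast?_singleton, Option.some.injEq] at hx hy
    exact absurd (hx ▸ hxX) (hy ▸ hyX)
  | @cons u v e vs es he hends hw ih =>
    simp only [List.head?_cons, Option.some.injEq] at hx
    subst hx
    by_cases hv : v ∈ X
    · obtain ⟨f, hf, h⟩ := ih rfl hv (by simpa using hy)
      exact ⟨f, List.mem_cons_of_mem _ hf, h⟩
    · obtain ⟨h1, h2⟩ := mem_V_of_ends he hends
      exact ⟨e, by simp, mem_cut.2 ⟨he, u, v, hends, h1, h2, hxX, hv⟩⟩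

theorem reachable_of_isChain {a : ℕ} {l : List ℕ} (h : (a :: l).IsChain G.Adj)
    (hS : ∀ v ∈ a :: l, v ∈ S) :
    ∀ v ∈ a :: l, (G.edgeGraph (G.inner S)).Reachable a v := by
  induction l generalizing a with
  | nil =>
    intro v hv
    rw [List.mem_singleton.1 hv]
  | cons b l ih =>
    intro v hv
    rcases List.mem_cons.1 hv with rfl | hv
    · exact SimpleGraph.Reachable.refl _
    · obtain ⟨hab, hl⟩ := List.isChain_cons_cons.1 h
      exact (hab.reachable (hS a (by simp)) (hS b (by simp))).trans
        (ih hl (fun w hw => hS w (List.mem_cons_of_mem _ hw)) v hv)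

theorem IsPathBetween.reachable (h : G.IsPathBetween x y vs es) (hS : ∀ v ∈ vs, v ∈ S) :
    (G.edgeGraph (G.inner S)).Reachable x y := by
  obtain ⟨hw, -, hx, hy⟩ := h
  cases vs with
  | nil => simp at hx
  | cons a l =>
    simp only [List.head?_cons, Option.some.injEq] at hx
    subst hx
    exact reachable_of_isChain hw.isChain hS y (List.mem_of_getLast? hy)

theorem ECon_of_kConnected {k : ℕ} (h : G.KConnected k) : G.ECon G.V k := by
  intro X a ha haX b hb hbX
  obtain ⟨P, hP, hPd⟩ := h.2 a ha b hb fun hab => hbX (hab ▸ haX)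
  choose e he hecut using fun i =>
    (hP i).1.exists_crossing (hP i).2.2.1 haX (hP i).2.2.2 hbX
  have hinj : Function.Injective e := by
    intro i j hij
    by_contra hne
    exact (hPd i j hne).2 (e i) (he i) (hij ▸ he j)
  simpa using Finset.card_le_card_of_injOn (s := Finset.univ) e (fun i _ => hecut i)
    hinj.injOn

theorem ECon_one_sdiff_pair (h : G.KConnected 3) (s₁ s₂ : ℕ) : G.ECon (G.V \ {s₁, s₂}) 1 := by
  apply ECon_one_of_reachable
  intro a ha b hb
  by_cases hab : a = b
  · rw [hab]
  simp only [Finset.mem_sdiff, Finset.mem_insert, Finset.mem_singleton, not_or] at ha hb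
  obtain ⟨P, hP, hPd⟩ := h.2 a ha.1 b hb.1 hab
  have huniq : ∀ s, s ≠ a → s ≠ b → ∀ i j, s ∈ (P i).1 → s ∈ (P j).1 → i = j := by
    intro s hsa hsb i j hi hj
    by_contra hne
    rcases (hPd i j hne).1 s hi hj with h | h
    · exact hsa h
    · exact hsb h
  have h₁ := huniq s₁ (Ne.symm ha.2.1) (Ne.symm hb.2.1)
  have h₂ := huniq s₂ (Ne.symm ha.2.2) (Ne.symm hb.2.2)
  obtain ⟨i, hi₁, hi₂⟩ : ∃ i, s₁ ∉ (P i).1 ∧ s₂ ∉ (P i).1 := by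
    by_contra! hall
    have h01 : (0 : Fin 3) ≠ 1 := by decide
    have h02 : (0 : Fin 3) ≠ 2 := by decide
    have h12 : (1 : Fin 3) ≠ 2 := by decide
    have := fun h h' => h01 (h₁ 0 1 h h')
    have := fun h h' => h02 (h₁ 0 2 h h')
    have := fun h h' => h12 (h₁ 1 2 h h')
    have := fun h h' => h01 (h₂ 0 1 h h')
    have := fun h h' => h02 (h₂ 0 2 h h')
    have := fun h h' => h12 (h₂ 1 2 h h')
    have := hall 0
    have := hall 1
    have := hall 2
    tauto
  refine (hP i).reachable fun v hv => ?_
  simp only [Finset.mem_sdiff, Finset.mem_insert, Finset.mem_singleton, not_or]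
  exact ⟨(hP i).1.mem_V v hv, fun h => hi₁ (h ▸ hv), fun h => hi₂ (h ▸ hv)⟩

/-- The interior of a path between non-adjacent vertices. -/
theorem IsPathBetween.exists_isSide (h : G.IsPathBetween x y vs es) (hne : x ≠ y)
    (hxy : ¬ G.Adj x y) :
    ∃ A, G.IsSide x y A ∧ ∀ v, v ∈ A ↔ v ∈ vs ∧ v ≠ x ∧ v ≠ y := by
  obtain ⟨hw, hnd, hx, hy⟩ := h
  obtain ⟨l, rfl⟩ : ∃ l, vs = x :: l := by
    cases vs with
    | nil => simp at hx
    | cons a l => exact ⟨l, by simpa using hx⟩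
  obtain ⟨m, rfl⟩ : ∃ m, l = m ++ [y] := by
    rcases List.eq_nil_or_concat l with rfl | ⟨m, b, rfl⟩
    · simp at hy; exact absurd hy hne
    · rw [List.concat_eq_append, ← List.cons_append, List.getLast?_concat] at hy
      exact ⟨m, by rw [List.concat_eq_append, Option.some.inj hy]⟩
  cases m with
  | nil =>
    have := hw.isChain
    simp at this
    exact absurd this hxy
  | cons a m =>
    have hc := hw.isChain
    rw [List.cons_append, List.isChain_cons_cons, ← List.cons_append, List.isChain_append] at hc
    obtain ⟨hxa, hcm, -, hlast⟩ := hc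
    have hxm : x ∉ a :: m := by
      have := (List.nodup_cons.1 hnd).1
      exact fun h => this (List.mem_append_left _ h)
    have hym : y ∉ a :: m := by
      have := (List.nodup_append.1 (List.nodup_cons.1 hnd).2).2.2
      exact fun h => this y h y (by simp) rfl
    refine ⟨(a :: m).toFinset, ⟨?_, by simpa using hxm, by simpa using hym, ?_, ?_, ?_⟩, ?_⟩
    · intro v hv
      exact hw.mem_V v (by simp at hv ⊢; tauto)
    · refine ECon_one_of_reachable_from (r := a) fun v hv => ?_
      exact reachable_of_isChain hcm (fun v hv => List.mem_toFinset.2 hv) v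
        (List.mem_toFinset.1 hv)
    · exact ⟨a, by simp, hxa.symm'⟩
    · refine ⟨(a :: m).getLast (by simp), List.mem_toFinset.2 (List.getLast_mem _), ?_⟩
      exact hlast _ (by rw [List.getLast?_eq_getLast_of_ne_nil (by simp)]; simp) y (by simp)
    · intro v
      rw [List.mem_toFinset]
      constructor
      · intro h
        exact ⟨List.mem_cons_of_mem _ (List.mem_append_left _ h), fun h' => hxm (h' ▸ h),
          fun h' => hym (h' ▸ h)⟩
      · rintro ⟨h, h1, h2⟩
        simpa [h1, h2] using h

theorem exists_isContractible (hG : G.Loopless) (h3 : G.KConnected 3) {d : ℕ} (hd : 1 ≤ d)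
    (hE : (d + 1) ^ (2 * d) * d < G.E.card) : ∃ U, G.IsContractible d U := by
  have hvc := ECon_one_sdiff_pair h3
  by_cases hdeg : ∃ v ∈ G.V, d ≤ (G.cut G.V {v}).card
  · obtain ⟨v, hv, hvd⟩ := hdeg
    refine ⟨{v}, Finset.singleton_subset_iff.2 hv, Finset.singleton_nonempty v, ?_, ?_, ?_, ?_⟩
    · rw [← Finset.card_pos, Finset.card_sdiff_of_subset (Finset.singleton_subset_iff.2 hv)]
      have := h3.1
      simp; omega
    · intro X a ha haX b hb hbX
      rw [Finset.mem_singleton.1 ha, ← Finset.mem_singleton.1 hb] at haX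
      exact absurd haX hbX
    · simpa using hvc v v
    · simpa using hvd
  push Not at hdeg
  have hEV : G.E ⊆ G.V.biUnion fun v => G.cut G.V {v} := by
    intro e he
    obtain ⟨a, b, hab⟩ := G.exists_ends e
    obtain ⟨ha, hb⟩ := mem_V_of_ends he hab
    exact Finset.mem_biUnion.2 ⟨a, ha, mem_cut.2 ⟨he, a, b, hab, ha, hb, rfl,
      fun h => hG.ne he hab h.symm⟩⟩
  have hcard := (Finset.card_le_card hEV).trans
    (Finset.card_biUnion_le_card_mul _ _ d fun v hv => (hdeg v hv).le)
  have hV : (d + 1) ^ (2 * d) < G.V.card :=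
    lt_of_mul_lt_mul_right (hE.trans_le hcard) (Nat.zero_le d)
  obtain ⟨x, hx⟩ : G.V.Nonempty := Finset.card_pos.1 (by omega)
  obtain ⟨y, hy, hfar⟩ := exists_far (a := x) (fun v hv => (hdeg v hv).le) hV
  have hxy : x ≠ y := by
    rintro rfl
    simpa using hfar SimpleGraph.Walk.nil
  have hadj : ¬ G.Adj x y := by
    rintro ⟨e, he, h⟩
    have := hfar (SimpleGraph.Adj.toWalk ⟨hxy, e, (mem_inner h).2 ⟨he, hx, hy⟩, h⟩)
    change 2 * d < 1 at this
    omega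
  obtain ⟨P, hP, hPd⟩ := h3.2 x hx y hy hxy
  obtain ⟨A, hA, hAP⟩ := (hP 0).exists_isSide hxy hadj
  obtain ⟨B, hB, hBP⟩ := (hP 1).exists_isSide hxy hadj
  refine exists_contractible_of_far hG (ECon_of_kConnected h3) hvc hx hadj hfar hA hB ?_ ?_
  · refine Finset.disjoint_left.2 fun v hvA hvB => ?_
    obtain ⟨hv, hvx, hvy⟩ := (hAP v).1 hvA
    exact ((hPd 0 1 (by decide)).1 v hv ((hBP v).1 hvB).1).elim hvx hvy
  · refine (hP 2).reachable fun v hv => Finset.mem_sdiff.2 ⟨(hP 2).1.mem_V v hv, fun h => ?_⟩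
    rcases Finset.mem_union.1 h with h | h
    · obtain ⟨hv', hvx, hvy⟩ := (hAP v).1 h
      exact ((hPd 0 2 (by decide)).1 v hv' hv).elim hvx hvy
    · obtain ⟨hv', hvx, hvy⟩ := (hBP v).1 h
      exact ((hPd 1 2 (by decide)).1 v hv' hv).elim hvx hvy

end MGraph

/-- For every `t ≥ 3` there is an integer `N` such that every simple 3-connected graph
with more than `N` edges has, as a cc-minor, a fan-type graph whose total number of
spokes is at least `t`. -/
theorem statement_16 (t : ℕ) (ht : 3 ≤ t) :
    ∃ N : ℕ, ∀ G : MGraph, G.Simple → G.KConnected 3 → N < G.E.card →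
      ∃ H u vs pE S, G.CCMinor H ∧ IsFanType H u vs pE S ∧
        t ≤ ∑ w ∈ vs.toFinset, (S w).card := by
  set d := t * (t + 1) ^ t + 1
  refine ⟨(d + 1) ^ (2 * d) * d, fun G hG h3 hE => ?_⟩
  obtain ⟨U, hU⟩ := MGraph.exists_isContractible hG.1 h3 (Nat.le_add_left 1 _) hE
  have hhub := MGraph.isHubbed_contractOn (S := ∅) hG.1 (MGraph.ECon_of_kConnected h3) hU.subset
    hU.nonempty hU.nonempty_compl hU.econ_compl
  obtain ⟨H, u, vs, pE, S, hH, hfan, hsum⟩ :=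
    hhub.exists_fan_of_deg (t := t) ((Nat.lt_succ_self _).trans_le hU.deg)
  exact ⟨H, u, vs, pE, S, Relation.ReflTransGen.trans
    (MGraph.ccMinor_contractOn _ le_rfl hG.1 hU.subset hU.nonempty hU.econ) hH, hfan, hsum⟩
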